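/- arXiv:math/0302284 — 2 statements merged into one kernel-verified Lean document; each statement's English description precedes it below -/
import Mathlib

section
/- There exists a model category structure on the category Flow of flows whose weak equivalences are exactly the weak S-homotopy equivalences. -/
open CategoryTheory

namespace Gaucher

/-- Helper: any map out of an empty space is continuous. -/
theorem continuous_of_isEmpty {α β : Type*} [TopologicalSpace α] [TopologicalSpace β]
    [IsEmpty α] (f : α → β) : Continuous f :=
  ⟨fun s _ => by rw [Set.eq_empty_of_isEmpty (f ⁻¹' s)]; exact isOpen_empty⟩

/-- Helper: fibers of constant maps are open. -/
theorem isOpen_preimage_const {α β : Type*} [TopologicalSpace α] (b a : β) :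
    IsOpen ((fun _ : α => b) ⁻¹' {a}) := by
  rcases eq_or_ne b a with h | h
  · rw [Set.preimage_const_of_mem (by simpa using h)]; exact isOpen_univ
  · rw [Set.preimage_const_of_notMem (by simpa using h)]; exact isOpen_empty

/-- A flow (Gaucher): a set of states (with the discrete topology), a topological
space of (non-constant) execution paths, source and target maps which are continuous
(i.e. have open fibers, the state set being discrete), and a continuous, associative
partial composition defined on composable pairs of paths. -/
structure Flow : Type 1 where
  /-- the `0`-skeleton, i.e. the set of states -/
  State : Type
  /-- the space of non-constant execution paths -/
  Path : Type
  [topPath : TopologicalSpace Path]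
  /-- source map -/
  s : Path → State
  /-- target map -/
  t : Path → State
  isOpen_preimage_s : ∀ a : State, IsOpen (s ⁻¹' {a})
  isOpen_preimage_t : ∀ a : State, IsOpen (t ⁻¹' {a})
  /-- composition of composable paths -/
  comp : ∀ x y : Path, t x = s y → Path
  continuous_comp : Continuous (fun p : { p : Path × Path // t p.1 = s p.2 } =>
    comp p.1.1 p.1.2 p.2)
  s_comp : ∀ x y h, s (comp x y h) = s x
  t_comp : ∀ x y h, t (comp x y h) = t y
  comp_assoc : ∀ (x y z : Path) (hxy : t x = s y) (hyz : t y = s z)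
    (h₁ : t x = s (comp y z hyz)) (h₂ : t (comp x y hxy) = s z),
    comp x (comp y z hyz) h₁ = comp (comp x y hxy) z h₂

attribute [instance] Flow.topPath

/-- The state set of a flow carries the discrete topology. -/
instance Flow.topState (X : Flow) : TopologicalSpace X.State := ⊥

instance (X : Flow) : DiscreteTopology X.State := ⟨rfl⟩

/-- A morphism of flows: a map preserving states, paths, sources, targets and
composition, continuous on the path spaces (continuity on the discrete state part
being automatic). -/
structure FlowHom (X Y : Flow) : Type where
  toFun0 : X.State → Y.State
  toFunP : X.Path → Y.Path
  continuous_toFunP : Continuous toFunP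
  s_map : ∀ x, Y.s (toFunP x) = toFun0 (X.s x)
  t_map : ∀ x, Y.t (toFunP x) = toFun0 (X.t x)
  comp_map : ∀ x y (h : X.t x = X.s y) (h' : Y.t (toFunP x) = Y.s (toFunP y)),
    toFunP (X.comp x y h) = Y.comp (toFunP x) (toFunP y) h'

theorem FlowHom.ext {X Y : Flow} {f g : FlowHom X Y}
    (h0 : f.toFun0 = g.toFun0) (hP : f.toFunP = g.toFunP) : f = g := by
  cases f; cases g; cases h0; cases hP; rfl

/-- The identity morphism of flows. -/
def FlowHom.id (X : Flow) : FlowHom X X where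
  toFun0 := _root_.id
  toFunP := _root_.id
  continuous_toFunP := continuous_id
  s_map _ := rfl
  t_map _ := rfl
  comp_map _ _ _ _ := rfl

/-- Composition of morphisms of flows (`g.comp f` is `g ∘ f`). -/
def FlowHom.comp {X Y Z : Flow} (g : FlowHom Y Z) (f : FlowHom X Y) : FlowHom X Z where
  toFun0 := g.toFun0 ∘ f.toFun0
  toFunP := g.toFunP ∘ f.toFunP
  continuous_toFunP := g.continuous_toFunP.comp f.continuous_toFunP
  s_map x := by simp only [Function.comp_apply, g.s_map, f.s_map]
  t_map x := by simp only [Function.comp_apply, g.t_map, f.t_map]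
  comp_map x y h h' := by
    have hY : Y.t (f.toFunP x) = Y.s (f.toFunP y) := by
      rw [f.t_map, f.s_map, h]
    show g.toFunP (f.toFunP (X.comp x y h)) = _
    rw [f.comp_map x y h hY, g.comp_map _ _ hY h']
    rfl

/-- The category `Flow` of flows. -/
instance : Category Flow where
  Hom := FlowHom
  id := FlowHom.id
  comp f g := g.comp f
  id_comp f := FlowHom.ext rfl rfl
  comp_id f := FlowHom.ext rfl rfl
  assoc f g h := FlowHom.ext rfl rfl

theorem FlowHom.comp_assoc {W X Y Z : Flow} (h : FlowHom Y Z) (g : FlowHom X Y)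
    (f : FlowHom W X) : (h.comp g).comp f = h.comp (g.comp f) :=
  FlowHom.ext rfl rfl

/-- The flow `Glob Z` associated to a topological space `Z`: two states `0` and `1`,
path space `Z`, every path going from `0` to `1` (no two paths are composable). -/
def Glob (Z : Type) [TopologicalSpace Z] : Flow where
  State := Fin 2
  Path := Z
  s := fun _ => 0
  t := fun _ => 1
  isOpen_preimage_s := fun a => isOpen_preimage_const _ a
  isOpen_preimage_t := fun a => isOpen_preimage_const _ a
  comp := fun _ _ h => absurd (show (1 : Fin 2) = 0 from h) (by decide)
  continuous_comp := by
    haveI : IsEmpty { p : Z × Z // (fun _ : Z => (1 : Fin 2)) p.1 = (fun _ : Z => (0 : Fin 2)) p.2 } :=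
      ⟨fun p => absurd (show (1 : Fin 2) = 0 from p.2) (by decide)⟩
    exact continuous_of_isEmpty _
  s_comp := fun x y h => absurd (show (1 : Fin 2) = 0 from h) (by decide)
  t_comp := fun x y h => absurd (show (1 : Fin 2) = 0 from h) (by decide)
  comp_assoc := fun x y z hxy => absurd (show (1 : Fin 2) = 0 from hxy) (by decide)

/-- Functoriality of `Glob`. -/
def Glob.map {Z W : Type} [TopologicalSpace Z] [TopologicalSpace W] (f : C(Z, W)) :
    FlowHom (Glob Z) (Glob W) where
  toFun0 := _root_.id
  toFunP := f
  continuous_toFunP := f.continuous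
  s_map _ := rfl
  t_map _ := rfl
  comp_map x y h := absurd (show (1 : Fin 2) = 0 from h) (by decide)

/-- The directed segment `I⃗` is `Glob` of a one-point space. -/
def dirSegment : Flow := Glob PUnit

/-- The flow with exactly one state and no non-constant execution path. -/
def pointFlow : Flow where
  State := PUnit
  Path := Empty
  s := fun e => e.elim
  t := fun e => e.elim
  isOpen_preimage_s := fun a => by
    rw [Set.eq_empty_of_isEmpty (_ ⁻¹' {a})]; exact isOpen_empty
  isOpen_preimage_t := fun a => by
    rw [Set.eq_empty_of_isEmpty (_ ⁻¹' {a})]; exact isOpen_empty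
  comp := fun x _ _ => x.elim
  continuous_comp := continuous_of_isEmpty _
  s_comp := fun x => x.elim
  t_comp := fun x => x.elim
  comp_assoc := fun x => x.elim

-- PART B (appended after part A) : S-homotopy, weak homotopy equivalences

/-- Two morphisms of flows `f g : X → Y` are S-homotopic: there is a continuous map
`H : (X⁰ ⊔ ℙX) × [0,1] → Y⁰ ⊔ ℙY` such that every `H(-,u)` is a morphism of flows,
`H(-,0) = f` and `H(-,1) = g`.  (Continuity of `H` on the two summands `ℙX × [0,1]`
and `X⁰ × [0,1]` — the state sets carrying the discrete topology — is exactly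
continuity of the two maps below.) -/
def SHomotopy {X Y : Flow} (f g : FlowHom X Y) : Prop :=
  ∃ F : unitInterval → FlowHom X Y,
    F 0 = f ∧ F 1 = g ∧
    Continuous (fun p : X.Path × unitInterval => (F p.2).toFunP p.1) ∧
    Continuous (fun p : X.State × unitInterval => (F p.2).toFun0 p.1)

/-- A morphism of flows is an S-homotopy equivalence if it admits an inverse up to
S-homotopy. -/
def IsSHomotopyEquiv {X Y : Flow} (f : FlowHom X Y) : Prop :=
  ∃ g : FlowHom Y X, SHomotopy (f.comp g) (FlowHom.id Y) ∧ SHomotopy (g.comp f) (FlowHom.id X)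

/-- Two flows are S-homotopy equivalent. -/
def SHomotopyEquivalent (X Y : Flow) : Prop :=
  ∃ f : FlowHom X Y, IsSHomotopyEquiv f

/-- The underlying continuous map on path spaces of a morphism of flows. -/
def FlowHom.pathMap {X Y : Flow} (f : FlowHom X Y) : C(X.Path, Y.Path) :=
  ⟨f.toFunP, f.continuous_toFunP⟩

/-- The map induced by a continuous map on `π₀` (path components). -/
def pi0Map {A B : Type*} [TopologicalSpace A] [TopologicalSpace B] (h : C(A, B)) :
    ZerothHomotopy A → ZerothHomotopy B :=
  Quotient.map h (fun _ _ j => ⟨j.somePath.map h.continuous⟩)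

/-- Push forward a generalized loop along a continuous map. -/
def GenLoop.push {A B : Type*} [TopologicalSpace A] [TopologicalSpace B] (h : C(A, B))
    {N : Type*} {x : A} (p : GenLoop N A x) : GenLoop N B (h x) :=
  ⟨h.comp p.1, fun y hy => by
    simp only [ContinuousMap.comp_apply]
    exact congrArg h (p.2 y hy)⟩

/-- The map induced by a continuous map on the `N`-th homotopy group. -/
def piMap {A B : Type*} [TopologicalSpace A] [TopologicalSpace B] (h : C(A, B))
    (N : Type*) (x : A) : HomotopyGroup N A x → HomotopyGroup N B (h x) :=
  Quotient.map (GenLoop.push h) (fun _ _ H =>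
    ⟨(Nonempty.some H).compContinuousMap h⟩)

/-- A continuous map is a weak homotopy equivalence: it induces a bijection on path
components and, for every base point and every `n`, a bijection on `πₙ`. -/
def IsWeakHomotopyEquiv {A B : Type*} [TopologicalSpace A] [TopologicalSpace B]
    (h : C(A, B)) : Prop :=
  Function.Bijective (pi0Map h) ∧
    ∀ (x : A) (n : ℕ), Function.Bijective (piMap h (Fin n) x)

/-- A morphism of flows is a weak S-homotopy equivalence if it induces a bijection
on the `0`-skeletons and a weak homotopy equivalence on the path spaces. -/
def IsWeakSHomotopyEquiv {X Y : Flow} (f : FlowHom X Y) : Prop :=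
  Function.Bijective f.toFun0 ∧ IsWeakHomotopyEquiv f.pathMap

-- PART C : S-cofibrant flows

/-- The sphere `S^{n-1}`, boundary of the closed `n`-disk `D^n`. -/
abbrev diskBoundary (n : ℕ) : Type := Metric.sphere (0 : EuclideanSpace ℝ (Fin n)) 1

/-- The closed `n`-disk `D^n`. -/
abbrev closedDisk (n : ℕ) : Type := Metric.closedBall (0 : EuclideanSpace ℝ (Fin n)) 1

/-- The inclusion `S^{n-1} ⊆ D^n`. -/
noncomputable def diskBoundaryInclusion (n : ℕ) : C(diskBoundary n, closedDisk n) :=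
  ⟨fun p => ⟨p.1, Metric.sphere_subset_closedBall p.2⟩,
    Continuous.subtype_mk continuous_subtype_val _⟩

/-- The inclusion of flows `Glob (S^{n-1}) → Glob (D^n)`. -/
noncomputable def globBoundaryInclusion (n : ℕ) : FlowHom (Glob (diskBoundary n)) (Glob (closedDisk n)) :=
  Glob.map (diskBoundaryInclusion n)

/-- A witness that a flow `X` is S-cofibrant: a skeletal filtration `sk 0 → sk 1 → ⋯`
where `sk 0` has empty path space (it is purely a discrete set of states), where
`sk (n+1)` is obtained from `sk n` as the pushout (expressed by its universal property,
`attach_isPushout`) of `⊔ᵢ Glob (S^{n-1}) → ⊔ᵢ Glob (D^n)` along attaching morphisms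
`Glob (S^{n-1}) → sk n` (for `n = 0` this attaches copies of the directed segment
`I⃗ = Glob(D⁰)` along `Glob(S^{-1}) = Glob(∅)`), and where `X` is the colimit
(expressed by its universal property `isColimit`) of the `sk n`. -/
structure SCofibrantStructure (X : Flow) : Type 1 where
  sk : ℕ → Flow
  isEmpty_path_sk_zero : IsEmpty (sk 0).Path
  ι : ∀ n, FlowHom (sk n) (sk (n + 1))
  cells : ℕ → Type
  attachMap : ∀ n, cells n → FlowHom (Glob (diskBoundary n)) (sk n)
  cellMap : ∀ n, cells n → FlowHom (Glob (closedDisk n)) (sk (n + 1))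
  attach_comm : ∀ n (i : cells n),
    (cellMap n i).comp (globBoundaryInclusion n) = (ι n).comp (attachMap n i)
  attach_isPushout : ∀ n (Z : Flow) (g : FlowHom (sk n) Z)
    (k : cells n → FlowHom (Glob (closedDisk n)) Z),
    (∀ i, (k i).comp (globBoundaryInclusion n) = g.comp (attachMap n i)) →
    ∃! h : FlowHom (sk (n + 1)) Z, h.comp (ι n) = g ∧ ∀ i, h.comp (cellMap n i) = k i
  incl : ∀ n, FlowHom (sk n) X
  incl_comm : ∀ n, (incl (n + 1)).comp (ι n) = incl n
  isColimit : ∀ (Z : Flow) (d : ∀ n, FlowHom (sk n) Z),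
    (∀ n, (d (n + 1)).comp (ι n) = d n) →
    ∃! h : FlowHom X Z, ∀ n, h.comp (incl n) = d n

/-- A flow is S-cofibrant if it admits a skeletal filtration as above. -/
def SCofibrant (X : Flow) : Prop :=
  Nonempty (SCofibrantStructure X)

-- PART D : the flow U ⊠ X, S-cofibrations, NDR pairs, the space FLOW(X,Y)

/-- The data exhibiting a flow `B` as a candidate for `U ⊠ X` (`U` a topological
space, `X` a flow): the generators, i.e. the states of `X` and a continuous family
`η (u, x)` of paths indexed by `U × ℙX`, subject to the defining relations
`s(u ⊠ x) = s x`, `t(u ⊠ x) = t x` and `(u ⊠ x) * (u ⊠ y) = u ⊠ (x * y)`. -/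
structure BoxCocone (U : Type) [TopologicalSpace U] (X B : Flow) : Type where
  η0 : X.State → B.State
  η : U × X.Path → B.Path
  continuous_η : Continuous η
  s_η : ∀ u x, B.s (η (u, x)) = η0 (X.s x)
  t_η : ∀ u x, B.t (η (u, x)) = η0 (X.t x)
  comp_η : ∀ u x y (h : X.t x = X.s y) (h' : B.t (η (u, x)) = B.s (η (u, y))),
    B.comp (η (u, x)) (η (u, y)) h' = η (u, X.comp x y h)

/-- `B`, equipped with the data `c`, *is* the flow `U ⊠ X`, i.e. the free flow
generated by `X⁰ ⊔ (U × ℙX)` quotiented by the relations `s (u,x) = s x`,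
`t (u,x) = t x` and `(u,x) * (u,y) = (u, x*y)`: every flow `Z` equipped with such
data receives a unique morphism of flows from `B` compatible with the data. -/
def IsBoxTimes {U : Type} [TopologicalSpace U] {X B : Flow} (c : BoxCocone U X B) : Prop :=
  ∀ (Z : Flow) (d : BoxCocone U X Z),
    ∃! f : FlowHom B Z, f.toFun0 ∘ c.η0 = d.η0 ∧ f.toFunP ∘ c.η = d.η

/-- For `u ∈ U`, the morphism of flows `X → U ⊠ X`, `x ↦ u ⊠ x`. -/
def BoxCocone.atTime {U : Type} [TopologicalSpace U] {X B : Flow}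
    (c : BoxCocone U X B) (u : U) : FlowHom X B where
  toFun0 := c.η0
  toFunP := fun x => c.η (u, x)
  continuous_toFunP := c.continuous_η.comp (Continuous.prodMk_right u)
  s_map x := c.s_η u x
  t_map x := c.t_η u x
  comp_map x y h h' := (c.comp_η u x y h h').symm

/-- Given box-product data `c : BoxCocone U A BUA` and `c' : BoxCocone V X BVX`, a
continuous map `φ : U → V` and a morphism of flows `f : A → X`, this asserts that
`m : BUA → BVX` is the canonically induced morphism `φ ⊠ f`, i.e. `u ⊠ a ↦ φ u ⊠ f a`. -/
def IsInducedBoxHom {U V : Type} [TopologicalSpace U] [TopologicalSpace V]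
    {A X BUA BVX : Flow} (c : BoxCocone U A BUA) (c' : BoxCocone V X BVX)
    (φ : U → V) (f : FlowHom A X) (m : FlowHom BUA BVX) : Prop :=
  (∀ a, m.toFun0 (c.η0 a) = c'.η0 (f.toFun0 a)) ∧
  (∀ u x, m.toFunP (c.η (u, x)) = c'.η (φ u, f.toFunP x))

/-- A morphism of flows `i : A → X` is an S-cofibration if it satisfies the
S-homotopy extension property: for every realization of `[0,1] ⊠ A` and `[0,1] ⊠ X`,
every morphism `g : X → Z` and every S-homotopy `H : [0,1] ⊠ A → Z` starting at
`g ∘ i`, there is an S-homotopy `H̄ : [0,1] ⊠ X → Z` with `H̄(u ⊠ i x) = H(u ⊠ x)`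
and `H̄(0 ⊠ y) = g y`. -/
def IsSCofibration {A X : Flow} (i : FlowHom A X) : Prop :=
  ∀ (IA IX : Flow) (cA : BoxCocone unitInterval A IA) (cX : BoxCocone unitInterval X IX),
    IsBoxTimes cA → IsBoxTimes cX →
    ∀ (Z : Flow) (g : FlowHom X Z) (H : FlowHom IA Z),
      H.comp (cA.atTime 0) = g.comp i →
      ∃ Hbar : FlowHom IX Z,
        (∀ u : unitInterval, (Hbar.comp ((cX.atTime u).comp i)) = H.comp (cA.atTime u)) ∧
        Hbar.comp (cX.atTime 0) = g

/-- `(Y, B)` is an NDR pair: `B` is closed in `Y` and there are `u : Y → [0,1]` with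
`B = u⁻¹(0)` and a homotopy `h : Y × [0,1] → Y` with `h(y,0) = y`, `h(b,t) = b` for
`b ∈ B`, and `h(y,1) ∈ B` as soon as `u y < 1`. -/
def IsNDRPair {Y : Type} [TopologicalSpace Y] (B : Set Y) : Prop :=
  IsClosed B ∧ ∃ (u : C(Y, unitInterval)) (h : C(Y × unitInterval, Y)),
    B = {y | u y = 0} ∧
    (∀ y, h (y, 0) = y) ∧
    (∀ b ∈ B, ∀ t, h (b, t) = b) ∧
    (∀ y, (u y : ℝ) < 1 → h (y, 1) ∈ B)

/-- `(Y, B)` is a DR pair: as for an NDR pair, but with `u y < 1` everywhere, so that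
`B` is a deformation retract of `Y`. -/
def IsDRPair {Y : Type} [TopologicalSpace Y] (B : Set Y) : Prop :=
  IsClosed B ∧ ∃ (u : C(Y, unitInterval)) (h : C(Y × unitInterval, Y)),
    B = {y | u y = 0} ∧
    (∀ y, h (y, 0) = y) ∧
    (∀ b ∈ B, ∀ t, h (b, t) = b) ∧
    (∀ y, (u y : ℝ) < 1 → h (y, 1) ∈ B) ∧
    (∀ y, (u y : ℝ) < 1)

/-- A morphism of flows, as a continuous map `X⁰ ⊔ ℙX → Y⁰ ⊔ ℙY`. -/
def FlowHom.toSumMap {X Y : Flow} (f : FlowHom X Y) :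
    C(X.State ⊕ X.Path, Y.State ⊕ Y.Path) :=
  ⟨Sum.map f.toFun0 f.toFunP,
    (continuous_of_discreteTopology (α := X.State)).sumMap f.continuous_toFunP⟩

/-- The set of morphisms of flows from `X` to `Y` carries the topology induced, via
`FlowHom.toSumMap`, by the compact-open topology. -/
def flowHomInducedTop (X Y : Flow) : TopologicalSpace (FlowHom X Y) :=
  TopologicalSpace.induced FlowHom.toSumMap ContinuousMap.compactOpen

/-- The space `FLOW(X,Y)`: morphisms of flows with the Kelleyfication of the induced
compact-open topology. -/
instance FlowHom.topologicalSpace (X Y : Flow) : TopologicalSpace (FlowHom X Y) :=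
  @TopologicalSpace.compactlyGenerated.{0} (FlowHom X Y) (flowHomInducedTop X Y)

-- PART E : model structures, localization, limits machinery

/-- The class of weak S-homotopy equivalences, as a class of morphisms of the
category `Flow`. -/
def weakSHomotopyEquivalences : MorphismProperty Flow :=
  fun _ _ f => IsWeakSHomotopyEquiv f

/-- `f` is a retract of `g` in the arrow category. -/
def IsRetractOfHom {C : Type*} [Category C] {X Y Z W : C} (f : X ⟶ Y) (g : Z ⟶ W) : Prop :=
  ∃ (i : X ⟶ Z) (r : Z ⟶ X) (i' : Y ⟶ W) (r' : W ⟶ Y),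
    i ≫ r = 𝟙 X ∧ i' ≫ r' = 𝟙 Y ∧ i ≫ g = f ≫ i' ∧ g ≫ r' = r ≫ f

/-- A model category structure (Quillen) on a category `C`: three classes of
morphisms — weak equivalences, cofibrations and fibrations — satisfying
two-out-of-three, stability under retracts, the lifting axioms and the
factorization axioms. -/
structure ModelStructure (C : Type*) [Category C] where
  weq : MorphismProperty C
  cof : MorphismProperty C
  fib : MorphismProperty C
  weq_two_out_of_three : weq.HasTwoOutOfThreeProperty
  weq_retract : ∀ {X Y Z W : C} (f : X ⟶ Y) (g : Z ⟶ W),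
    IsRetractOfHom f g → weq g → weq f
  cof_retract : ∀ {X Y Z W : C} (f : X ⟶ Y) (g : Z ⟶ W),
    IsRetractOfHom f g → cof g → cof f
  fib_retract : ∀ {X Y Z W : C} (f : X ⟶ Y) (g : Z ⟶ W),
    IsRetractOfHom f g → fib g → fib f
  lift_cof_trivFib : ∀ {A B P Q : C} (i : A ⟶ B) (p : P ⟶ Q),
    cof i → fib p → weq p → HasLiftingProperty i p
  lift_trivCof_fib : ∀ {A B P Q : C} (i : A ⟶ B) (p : P ⟶ Q),
    cof i → weq i → fib p → HasLiftingProperty i p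
  fact_cof_trivFib : ∀ {X Y : C} (f : X ⟶ Y),
    ∃ (Z : C) (i : X ⟶ Z) (p : Z ⟶ Y), cof i ∧ fib p ∧ weq p ∧ i ≫ p = f
  fact_trivCof_fib : ∀ {X Y : C} (f : X ⟶ Y),
    ∃ (Z : C) (i : X ⟶ Z) (p : Z ⟶ Y), cof i ∧ weq i ∧ fib p ∧ i ≫ p = f

/-- The S-homotopy relation, as a relation on the morphisms of the full subcategory
of S-cofibrant flows. -/
def sHomotopyHomRel : HomRel (ObjectProperty.FullSubcategory SCofibrant) :=
  fun {_ _} f g => SHomotopy f.hom g.hom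

/-- The canonical map `FLOW(X, lim Yⱼ) → lim FLOW(X, Yⱼ)`, the target being realized
as the subspace of the product `Π j, FLOW(X, Yⱼ)` consisting of the compatible
families. -/
def canonicalMapToLimit (X : Flow) {J : Type} [SmallCategory J] (D : J ⥤ Flow)
    (c : Limits.Cone D) :
    FlowHom X c.pt →
      {p : ∀ j, FlowHom X (D.obj j) // ∀ ⦃j j' : J⦄ (φ : j ⟶ j'),
        (D.map φ).comp (p j) = p j'} :=
  fun g => ⟨fun j => (c.π.app j).comp g, by
    intro j j' φ
    have h := c.π.naturality φ
    have h2 : FlowHom.comp (D.map φ) (c.π.app j) = c.π.app j' := by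
      have h3 := h.symm.trans
        (show ((Functor.const J).obj c.pt).map φ ≫ c.π.app j' = c.π.app j' from
          FlowHom.ext rfl rfl)
      exact h3
    show FlowHom.comp (D.map φ) (FlowHom.comp (c.π.app j) g) = FlowHom.comp (c.π.app j') g
    rw [← FlowHom.comp_assoc, h2]⟩

set_option linter.unusedVariables false

section PartA

/-! ### Balls, cubes and the homotopy extension property -/

open unitInterval in
/-- `A` is the boundary of a ball `X`. -/
def IsBall (X : Type) [TopologicalSpace X] (A : Set X) : Prop :=
  ∃ (V : Type) (_ : NormedAddCommGroup V) (_ : NormedSpace ℝ V) (e : X → V) (g : V → X),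
    Continuous e ∧ Continuous g ∧ (∀ x, g (e x) = x) ∧ (∀ x, ‖e x‖ ≤ 1) ∧
    (∀ v, ‖v‖ ≤ 1 → e (g v) = v) ∧ ∀ x, x ∈ A ↔ ‖e x‖ = 1

/-- The open box `X × 0 ∪ A × I`. -/
def box {X : Type} (A : Set X) : Set (X × unitInterval) := {p | p.2 = 0 ∨ p.1 ∈ A}

/-- The full boundary `X × {0,1} ∪ A × I`. -/
def bdry {X : Type} (A : Set X) : Set (X × unitInterval) := {p | p.2 = 1 ∨ p ∈ box A}

/-- Homotopy extension property, through a retraction. -/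
def HEP (X : Type) [TopologicalSpace X] (A : Set X) : Prop :=
  ∃ r : C(X × unitInterval, X × unitInterval), (∀ p, r p ∈ box A) ∧ ∀ p ∈ box A, r p = p

theorem IsBall.isClosed {X : Type} [TopologicalSpace X] {A : Set X} (h : IsBall X A) :
    IsClosed A := by
  obtain ⟨V, _, _, e, g, he, hg, h1, h2, h3, h4⟩ := h
  have : A = (fun x => ‖e x‖) ⁻¹' {1} := by ext x; simp [h4]
  rw [this]
  exact isClosed_singleton.preimage he.norm

theorem isClosed_box {X : Type} [TopologicalSpace X] {A : Set X} (h : IsClosed A) :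
    IsClosed (box A) :=
  (isClosed_singleton.preimage continuous_snd).union (h.preimage continuous_fst)

theorem isClosed_bdry {X : Type} [TopologicalSpace X] {A : Set X} (h : IsClosed A) :
    IsClosed (bdry A) :=
  (isClosed_singleton.preimage continuous_snd).union (isClosed_box h)

theorem IsBall.hep {X : Type} [TopologicalSpace X] {A : Set X} (h : IsBall X A) :
    HEP X A := by
  obtain ⟨V, _, _, e, g, he, hg, h1, h2, h3, h4⟩ := h
  let D : X × unitInterval → ℝ := fun p => max ((2 - (p.2 : ℝ)) / 2) ‖e p.1‖
  have hDc : Continuous D := by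
    unfold D
    fun_prop
  have hD1 : ∀ p, D p ≤ 1 := fun p => max_le (by have := p.2.2.1; linarith) (h2 _)
  have hD2 : ∀ p, 1 / 2 ≤ D p := fun p => le_max_of_le_left (by have := p.2.2.2; linarith)
  have hD0 : ∀ p, 0 < D p := fun p => by have := hD2 p; linarith
  have hDa : ∀ p, (2 - (p.2 : ℝ)) / 2 ≤ D p := fun p => le_max_left _ _
  have hDb : ∀ p, ‖e p.1‖ ≤ D p := fun p => le_max_right _ _
  let v : X × unitInterval → V := fun p => (D p)⁻¹ • e p.1
  have hv : ∀ p, ‖v p‖ = ‖e p.1‖ / D p := fun p => by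
    simp only [v, norm_smul, norm_inv, Real.norm_eq_abs, abs_of_pos (hD0 p)]
    rw [inv_mul_eq_div]
  have hv1 : ∀ p, ‖v p‖ ≤ 1 := fun p => by
    rw [hv, div_le_one (hD0 p)]; exact hDb p
  let w : X × unitInterval → ℝ := fun p => 2 - (2 - (p.2 : ℝ)) / D p
  have hw0 : ∀ p, 0 ≤ w p := fun p => by
    have : (2 - (p.2 : ℝ)) / D p ≤ 2 := by
      rw [div_le_iff₀ (hD0 p)]; have := hDa p; linarith
    simp only [w]; linarith
  have hw1 : ∀ p, w p ≤ 1 := fun p => by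
    have : 1 ≤ (2 - (p.2 : ℝ)) / D p := by
      rw [le_div_iff₀ (hD0 p)]; have := hD1 p; have := p.2.2.2; linarith
    simp only [w]; linarith
  refine ⟨⟨fun p => (g (v p), ⟨w p, hw0 p, hw1 p⟩), ?_⟩, ?_, ?_⟩
  · have hDi : Continuous fun p => (D p)⁻¹ := hDc.inv₀ fun p => (hD0 p).ne'
    refine (hg.comp (hDi.smul (he.comp continuous_fst))).prodMk (Continuous.subtype_mk ?_ _)
    refine continuous_const.sub ?_
    exact Continuous.div (by fun_prop) hDc fun p => (hD0 p).ne'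
  · intro p
    rcases le_total ((2 - (p.2 : ℝ)) / 2) ‖e p.1‖ with hle | hle
    · right
      have hDp : D p = ‖e p.1‖ := max_eq_right hle
      show g (v p) ∈ A
      rw [h4, h3 _ (hv1 p), hv, hDp, div_self]
      rw [← hDp]; exact (hD0 p).ne'
    · left
      have hDp : D p = (2 - (p.2 : ℝ)) / 2 := max_eq_left hle
      apply Subtype.ext
      show w p = 0
      have : (2 - (p.2 : ℝ)) = 2 * D p := by rw [hDp]; ring
      simp only [w]
      rw [this, mul_div_assoc, div_self (hD0 p).ne']; norm_num
  · intro p hp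
    have hDp : D p = 1 := by
      refine le_antisymm (hD1 p) ?_
      rcases hp with hp | hp
      · have := hDa p; rw [hp] at this; simpa using this
      · have := hDb p; rwa [(h4 _).1 hp] at this
    refine Prod.ext ?_ (Subtype.ext ?_)
    · show g (v p) = p.1
      simp only [v, hDp, inv_one, one_smul, h1]
    · show w p = p.2
      simp only [w, hDp]; ring

theorem isBall_I : IsBall unitInterval {t | t = 1 ∨ t = 0} := by
  refine ⟨ℝ, inferInstance, inferInstance, fun x => 2 * (x : ℝ) - 1,
    fun v => Set.projIcc 0 1 zero_le_one ((v + 1) / 2), by fun_prop, ?_, ?_, ?_, ?_, ?_⟩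
  · exact continuous_projIcc.comp (by fun_prop)
  · intro x
    have : (2 * (x : ℝ) - 1 + 1) / 2 = x := by ring
    simp only [this]
    exact Set.projIcc_val zero_le_one x
  · intro x
    rw [Real.norm_eq_abs, abs_le]
    have := x.2.1; have := x.2.2
    constructor <;> linarith
  · intro v hv
    rw [Real.norm_eq_abs, abs_le] at hv
    simp only
    rw [Set.projIcc_of_mem zero_le_one (show (v + 1) / 2 ∈ Set.Icc (0 : ℝ) 1 from
      ⟨by linarith, by linarith⟩)]
    simp only; ring
  · intro x
    simp only [Set.mem_ofPred_eq, Real.norm_eq_abs]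
    constructor
    · rintro (rfl | rfl) <;> norm_num
    · intro h
      rcases (abs_eq zero_le_one).1 h with h | h
      · left; apply Subtype.ext; show (x : ℝ) = 1; linarith
      · right; apply Subtype.ext; show (x : ℝ) = 0; linarith

theorem IsBall.bdry {X : Type} [TopologicalSpace X] {A : Set X} (h : IsBall X A) :
    IsBall (X × unitInterval) (bdry A) := by
  obtain ⟨V, _, _, e, g, he, hg, h1, h2, h3, h4⟩ := h
  obtain ⟨W, _, _, e', g', he', hg', h1', h2', h3', h4'⟩ := isBall_I
  refine ⟨V × W, inferInstance, inferInstance, Prod.map e e', Prod.map g g',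
    he.prodMap he', hg.prodMap hg', ?_, ?_, ?_, ?_⟩
  · intro x; exact Prod.ext (h1 _) (h1' _)
  · intro x; simp [Prod.norm_def, h2, h2']
  · intro v hv
    rw [Prod.norm_def] at hv
    exact Prod.ext (h3 _ ((le_max_left _ _).trans hv)) (h3' _ ((le_max_right _ _).trans hv))
  · intro x
    have hx := h2 x.1
    have hx' := h2' x.2
    have a := h4 x.1
    have b := h4' x.2
    simp only [Set.mem_ofPred_eq] at b
    simp only [Gaucher.bdry, box, Set.mem_ofPred_eq, Prod.norm_def, Prod.map]
    rw [← or_assoc, b, a]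
    constructor
    · rintro (h | h)
      · rw [h]; exact max_eq_right hx
      · rw [h]; exact max_eq_left hx'
    · intro h
      rcases max_choice ‖e x.1‖ ‖e' x.2‖ with h' | h'
      · right; rw [← h, h']
      · left; rw [← h, h']

/-- The cube. -/
abbrev Cb (n : ℕ) : Type := Fin n → unitInterval
/-- The boundary of the cube. -/
abbrev dCb (n : ℕ) : Set (Cb n) := Cube.boundary (Fin n)

/-- Splitting off a coordinate of the cube. -/
def cbHomeo (n : ℕ) : Cb n × unitInterval ≃ₜ Cb (n + 1) where
  toFun p := Fin.cons p.2 p.1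
  invFun y := (fun i => y i.succ, y 0)
  left_inv p := by simp
  right_inv y := by
    funext i
    refine Fin.cases ?_ (fun i => ?_) i <;> simp
  continuous_toFun := by
    refine continuous_pi fun i => ?_
    refine Fin.cases ?_ (fun i => ?_) i
    · simpa using continuous_snd
    · simp only [Fin.cons_succ]; fun_prop
  continuous_invFun := by fun_prop

theorem cbHomeo_mem (n : ℕ) (p : Cb n × unitInterval) :
    cbHomeo n p ∈ dCb (n + 1) ↔ p ∈ bdry (dCb n) := by
  show (∃ i, (Fin.cons p.2 p.1 : Cb (n + 1)) i = 0 ∨ (Fin.cons p.2 p.1 : Cb (n + 1)) i = 1) ↔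
    (p.2 = 1 ∨ p.2 = 0 ∨ ∃ i, p.1 i = 0 ∨ p.1 i = 1)
  rw [Fin.exists_fin_succ]
  simp only [Fin.cons_zero, Fin.cons_succ]
  rw [or_comm (a := p.2 = 0), or_assoc]

theorem IsBall.congr {X Y : Type} [TopologicalSpace X] [TopologicalSpace Y] (c : X ≃ₜ Y)
    {A : Set X} {B : Set Y} (hc : ∀ x, c x ∈ B ↔ x ∈ A) (h : IsBall X A) : IsBall Y B := by
  obtain ⟨V, _, _, e, g, he, hg, h1, h2, h3, h4⟩ := h
  refine ⟨V, inferInstance, inferInstance, e ∘ c.symm, c ∘ g, he.comp c.symm.continuous,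
    c.continuous.comp hg, ?_, ?_, ?_, ?_⟩
  · intro x; simp [h1]
  · intro x; simp [h2]
  · intro v hv; simp [h3 v hv]
  · intro y
    obtain ⟨x, rfl⟩ := c.surjective y
    rw [hc, h4]; simp

theorem isBall_cb (n : ℕ) : IsBall (Cb n) (dCb n) := by
  induction n with
  | zero =>
    refine ⟨PUnit, inferInstance, inferInstance, fun _ => 0, fun _ => 0, continuous_const,
      continuous_const, fun x => Subsingleton.elim _ _, fun x => by simp, fun v _ => rfl, ?_⟩
    intro x
    simp [Cube.boundary]
  | succ n ih => exact ih.bdry.congr (cbHomeo n) (cbHomeo_mem n)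

/-- Gluing along two closed sets. -/
theorem continuousOn_glue {X Y : Type} [TopologicalSpace X] [TopologicalSpace Y] {s u : Set X}
    (hs : IsClosed s) (hu : IsClosed u) {f g k : X → Y} (hf : ContinuousOn f s)
    (hg : ContinuousOn g u) (hkf : ∀ x ∈ s, k x = f x) (hkg : ∀ x ∈ u, k x = g x) :
    ContinuousOn k (s ∪ u) :=
  (hf.congr hkf).union_of_isClosed (hg.congr hkg) hs hu

theorem HEP.extend {X : Type} [TopologicalSpace X] {A : Set X} (h : HEP X A) {Y : Type}
    [TopologicalSpace Y] (k : X × unitInterval → Y) (hk : ContinuousOn k (box A)) :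
    ∃ l : C(X × unitInterval, Y), ∀ p ∈ box A, l p = k p := by
  obtain ⟨r, h1, h2⟩ := h
  refine ⟨⟨fun p => k (r p), hk.comp_continuous r.continuous h1⟩, fun p hp => ?_⟩
  show k (r p) = k p
  rw [h2 p hp]

open Classical in
theorem HEP.extend' {X : Type} [TopologicalSpace X] {A : Set X} (h : HEP X A)
    (hA : IsClosed A) {Y : Type}
    [TopologicalSpace Y] (f : C(X, Y)) (k : X × unitInterval → Y)
    (hk : ContinuousOn k {p | p.1 ∈ A}) (hfk : ∀ x ∈ A, k (x, 0) = f x) :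
    ∃ l : C(X × unitInterval, Y), (∀ x, l (x, 0) = f x) ∧ ∀ x ∈ A, ∀ t, l (x, t) = k (x, t) := by
  obtain ⟨l, hl⟩ := h.extend (fun p => if p.1 ∈ A then k p else f p.1) (by
    refine continuousOn_glue (isClosed_singleton.preimage continuous_snd)
      (hA.preimage continuous_fst) (f := fun p => f p.1) (g := k) (by fun_prop) hk ?_ ?_
    · rintro ⟨x, t⟩ (rfl : t = 0)
      by_cases hx : x ∈ A
      · simp [hx, hfk]
      · simp [hx]
    · rintro ⟨x, t⟩ (hx : x ∈ A)
      simp [hx])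
  refine ⟨l, fun x => ?_, fun x hx t => ?_⟩
  · rw [hl _ (Or.inl rfl)]
    by_cases hx : x ∈ A
    · simp [hx, hfk]
    · simp [hx]
  · rw [hl _ (Or.inr hx)]; simp [hx]

end PartA

section PartB

/-! ### Weak homotopy equivalences, unbundled -/

/-- Homotopy relative to the boundary of the cube. -/
def Hrel {n : ℕ} {Y : Type} [TopologicalSpace Y] (z z' : C(Cb n, Y)) : Prop :=
  ∃ H : C(Cb n × unitInterval, Y), (∀ x, H (x, 0) = z x) ∧ (∀ x, H (x, 1) = z' x) ∧
    ∀ x ∈ dCb n, ∀ t, H (x, t) = z x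

theorem hrel_iff {n : ℕ} {Y : Type} [TopologicalSpace Y] (z z' : C(Cb n, Y)) :
    Hrel z z' ↔ z.HomotopicRel z' (dCb n) := by
  constructor
  · rintro ⟨H, h0, h1, h2⟩
    refine ⟨{ toFun := fun p => H (p.2, p.1), continuous_toFun := by fun_prop,
              map_zero_left := h0, map_one_left := h1, prop' := fun t x hx => h2 x hx t }⟩
  · rintro ⟨H⟩
    refine ⟨⟨fun p => H (p.2, p.1), by fun_prop⟩, fun x => H.apply_zero x,
      fun x => H.apply_one x, fun x hx t => H.eq_fst t hx⟩

theorem Hrel.symm {n : ℕ} {Y : Type} [TopologicalSpace Y] {z z' : C(Cb n, Y)} (h : Hrel z z') :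
    Hrel z' z := by
  rw [hrel_iff] at *; exact h.symm

theorem Hrel.refl {n : ℕ} {Y : Type} [TopologicalSpace Y] (z : C(Cb n, Y)) :
    Hrel z z := by
  rw [hrel_iff]; exact ContinuousMap.HomotopicRel.refl _

theorem Hrel.trans {n : ℕ} {Y : Type} [TopologicalSpace Y] {z z' z'' : C(Cb n, Y)}
    (h : Hrel z z') (h' : Hrel z' z'') : Hrel z z'' := by
  rw [hrel_iff] at *; exact h.trans h'

theorem Hrel.map {n : ℕ} {Y Z : Type} [TopologicalSpace Y] [TopologicalSpace Z]
    {z z' : C(Cb n, Y)} (h : Hrel z z') (f : C(Y, Z)) : Hrel (f.comp z) (f.comp z') := by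
  obtain ⟨H, h0, h1, h2⟩ := h
  exact ⟨f.comp H, fun x => congrArg f (h0 x), fun x => congrArg f (h1 x),
    fun x hx t => congrArg f (h2 x hx t)⟩

/-- Surjectivity on homotopy groups at a base point. -/
def PiSurj {A B : Type} [TopologicalSpace A] [TopologicalSpace B] (h : C(A, B)) (n : ℕ)
    (x : A) : Prop :=
  ∀ q : C(Cb n, B), (∀ y ∈ dCb n, q y = h x) →
    ∃ z : C(Cb n, A), (∀ y ∈ dCb n, z y = x) ∧ Hrel (h.comp z) q

/-- Injectivity on homotopy groups at a base point. -/
def PiInj {A B : Type} [TopologicalSpace A] [TopologicalSpace B] (h : C(A, B)) (n : ℕ)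
    (x : A) : Prop :=
  ∀ z z' : C(Cb n, A), (∀ y ∈ dCb n, z y = x) → (∀ y ∈ dCb n, z' y = x) →
    Hrel (h.comp z) (h.comp z') → Hrel z z'

/-- Unbundled weak homotopy equivalence. -/
structure WE {A B : Type} [TopologicalSpace A] [TopologicalSpace B] (h : C(A, B)) : Prop where
  surj0 : ∀ b, ∃ a, Joined (h a) b
  inj0 : ∀ a a', Joined (h a) (h a') → Joined a a'
  surj : ∀ n x, PiSurj h n x
  inj : ∀ n x, PiInj h n x

theorem isWeakHomotopyEquiv_iff {A B : Type} [TopologicalSpace A] [TopologicalSpace B]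
    (h : C(A, B)) : IsWeakHomotopyEquiv h ↔ WE h := by
  constructor
  · rintro ⟨⟨i0, s0⟩, hp⟩
    refine ⟨fun b => ?_, fun a a' haa => ?_, fun n x q hq => ?_, fun n x z z' hz hz' H => ?_⟩
    · obtain ⟨a, ha⟩ := s0 (Quotient.mk _ b)
      induction a using Quotient.inductionOn with
      | _ a => exact ⟨a, Quotient.exact ha⟩
    · exact Quotient.exact (i0 (a₁ := Quotient.mk _ a) (a₂ := Quotient.mk _ a')
        (Quotient.sound haa))
    · obtain ⟨z, hz⟩ := (hp x n).2 (Quotient.mk _ ⟨q, hq⟩)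
      induction z using Quotient.inductionOn with
      | _ z => exact ⟨z.1, z.2, (hrel_iff _ _).2 (Quotient.exact hz)⟩
    · rw [hrel_iff] at *
      exact Quotient.exact ((hp x n).1 (a₁ := Quotient.mk _ ⟨z, hz⟩)
        (a₂ := Quotient.mk _ ⟨z', hz'⟩) (Quotient.sound H))
  · rintro ⟨s0, i0, s, i⟩
    refine ⟨⟨?_, ?_⟩, fun x n => ⟨?_, ?_⟩⟩
    · intro a a' haa
      induction a using Quotient.inductionOn with
      | _ a =>
      induction a' using Quotient.inductionOn with
      | _ a' => exact Quotient.sound (i0 _ _ (Quotient.exact haa))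
    · intro b
      induction b using Quotient.inductionOn with
      | _ b =>
        obtain ⟨a, ha⟩ := s0 b
        exact ⟨Quotient.mk _ a, Quotient.sound ha⟩
    · intro z z' hzz
      induction z using Quotient.inductionOn with
      | _ z =>
      induction z' using Quotient.inductionOn with
      | _ z' =>
        refine Quotient.sound ((hrel_iff _ _).1 (i n x z.1 z'.1 z.2 z'.2 ?_))
        exact (hrel_iff _ _).2 (Quotient.exact hzz)
    · intro q
      induction q using Quotient.inductionOn with
      | _ q =>
        obtain ⟨z, hz, H⟩ := s n x q.1 q.2
        exact ⟨Quotient.mk _ ⟨z, hz⟩, Quotient.sound ((hrel_iff _ _).1 H)⟩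

section TwoOutOfThree

variable {X Y Z : Type} [TopologicalSpace X] [TopologicalSpace Y] [TopologicalSpace Z]

theorem WE.comp {g : C(Y, Z)} {f : C(X, Y)} (hg : WE g) (hf : WE f) : WE (g.comp f) where
  surj0 z := by
    obtain ⟨y, hy⟩ := hg.surj0 z
    obtain ⟨x, hx⟩ := hf.surj0 y
    exact ⟨x, Joined.trans (hx.map g.continuous) hy⟩
  inj0 a a' h := hf.inj0 _ _ (hg.inj0 _ _ h)
  surj n x q hq := by
    obtain ⟨y, hy, H⟩ := hg.surj n (f x) q hq
    obtain ⟨w, hw, H'⟩ := hf.surj n x y hy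
    exact ⟨w, hw, (H'.map g).trans H⟩
  inj n x z z' hz hz' H := by
    refine hf.inj n x z z' hz hz' (hg.inj n (f x) _ _ ?_ ?_ H)
    · intro y hy; exact congrArg f (hz y hy)
    · intro y hy; exact congrArg f (hz' y hy)

theorem WE.of_comp_left {g : C(Y, Z)} {f : C(X, Y)} (hg : WE g) (h : WE (g.comp f)) : WE f where
  surj0 y := by
    obtain ⟨x, hx⟩ := h.surj0 (g y)
    exact ⟨x, hg.inj0 _ _ hx⟩
  inj0 a a' haa := h.inj0 _ _ (haa.map g.continuous)
  surj n x q hq := by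
    obtain ⟨w, hw, H⟩ := h.surj n x (g.comp q) (fun y hy => congrArg g (hq y hy))
    exact ⟨w, hw, hg.inj n (f x) _ _ (fun y hy => congrArg f (hw y hy)) hq H⟩
  inj n x z z' hz hz' H := h.inj n x z z' hz hz' (H.map g)

/-- Free homotopy along a path of base points. -/
def Tr {n : ℕ} (γ : C(unitInterval, Y)) (q q' : C(Cb n, Y)) : Prop :=
  ∃ H : C(Cb n × unitInterval, Y), (∀ x, H (x, 0) = q x) ∧ (∀ x, H (x, 1) = q' x) ∧
    ∀ x ∈ dCb n, ∀ t, H (x, t) = γ t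

/-- The reversed path. -/
def rev (γ : C(unitInterval, Y)) : C(unitInterval, Y) := ⟨fun t => γ (unitInterval.symm t), by fun_prop⟩

theorem Tr.rev {n : ℕ} {γ : C(unitInterval, Y)} {q q' : C(Cb n, Y)} (h : Tr γ q q') :
    Tr (rev γ) q' q := by
  obtain ⟨H, h0, h1, h2⟩ := h
  refine ⟨⟨fun p => H (p.1, unitInterval.symm p.2), by fun_prop⟩, ?_, ?_, ?_⟩
  · intro x; simp [h1]
  · intro x; simp [h0]
  · intro x hx t; exact h2 x hx _

theorem rev_rev (γ : C(unitInterval, Y)) : rev (rev γ) = γ := by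
  ext t; simp [rev]

theorem exists_tr {n : ℕ} (γ : C(unitInterval, Y)) (q : C(Cb n, Y))
    (hq : ∀ x ∈ dCb n, q x = γ 0) :
    ∃ q' : C(Cb n, Y), (∀ x ∈ dCb n, q' x = γ 1) ∧ Tr γ q q' := by
  obtain ⟨l, hl, hl'⟩ := (isBall_cb n).hep.extend' (isBall_cb n).isClosed q (fun p => γ p.2)
    (by fun_prop) (fun x hx => (hq x hx).symm)
  exact ⟨⟨fun x => l (x, 1), by fun_prop⟩, fun x hx => hl' x hx 1, l, hl, fun x => rfl, hl'⟩

open Classical in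
theorem Tr.hrel {n : ℕ} {γ : C(unitInterval, Y)} {q q' r r' : C(Cb n, Y)} (h : Tr γ q q')
    (h' : Tr γ r r') (H : Hrel q r) : Hrel q' r' := by
  obtain ⟨A, a0, a1, a2⟩ := h
  obtain ⟨B, b0, b1, b2⟩ := h'
  obtain ⟨H, h0, h1, h2⟩ := H
  have hcl := (isBall_cb n).isClosed
  let k : (Cb n × unitInterval) × unitInterval → Y := fun p =>
    if p.1.2 = 0 then A (p.1.1, p.2) else if p.1.2 = 1 then B (p.1.1, p.2) else γ p.2
  have k0 : ∀ x t, k ((x, 0), t) = A (x, t) := fun x t => by simp [k]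
  have k1 : ∀ x t, k ((x, 1), t) = B (x, t) := fun x t => by simp [k]
  have k2 : ∀ x ∈ dCb n, ∀ s t, k ((x, s), t) = γ t := fun x hx s t => by
    simp only [k]; split_ifs
    · exact a2 x hx t
    · exact b2 x hx t
    · rfl
  obtain ⟨l, hl, hl'⟩ := (isBall_cb n).bdry.hep.extend' (isClosed_bdry hcl) H k (by
      have c1 : IsClosed {p : (Cb n × unitInterval) × unitInterval | p.1.2 = 1} :=
        isClosed_singleton.preimage (continuous_snd.comp continuous_fst)
      have c0 : IsClosed {p : (Cb n × unitInterval) × unitInterval | p.1.2 = 0} :=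
        isClosed_singleton.preimage (continuous_snd.comp continuous_fst)
      have c2 : IsClosed {p : (Cb n × unitInterval) × unitInterval | p.1.1 ∈ dCb n} :=
        hcl.preimage (continuous_fst.comp continuous_fst)
      refine continuousOn_glue c1 (c0.union c2) (f := fun p => B (p.1.1, p.2)) (g := k)
        (by fun_prop) ?_ ?_ (fun _ _ => rfl)
      · refine continuousOn_glue c0 c2 (f := fun p => A (p.1.1, p.2)) (g := fun p => γ p.2)
          (by fun_prop) (by fun_prop) ?_ ?_
        · rintro ⟨⟨x, s⟩, t⟩ (rfl : s = 0); exact k0 x t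
        · rintro ⟨⟨x, s⟩, t⟩ hx; exact k2 x hx s t
      · rintro ⟨⟨x, s⟩, t⟩ (rfl : s = 1); exact k1 x t) (by
      rintro ⟨x, s⟩ (hs | hs | hs)
      · obtain rfl : s = 1 := hs
        rw [k1, b0, h1]
      · obtain rfl : s = 0 := hs
        rw [k0, a0, h0]
      · rw [k2 x hs, h2 x hs, ← a0, a2 x hs])
  refine ⟨⟨fun p => l (p, 1), by fun_prop⟩, ?_, ?_, ?_⟩
  · intro x
    show l ((x, 0), 1) = _
    rw [hl' _ (Or.inr (Or.inl rfl)), k0, a1]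
  · intro x
    show l ((x, 1), 1) = _
    rw [hl' _ (Or.inl rfl), k1, b1]
  · intro x hx t
    show l ((x, t), 1) = _
    rw [hl' _ (Or.inr (Or.inr hx)), k2 x hx, ← a1, a2 x hx]

theorem Tr.map {n : ℕ} {γ : C(unitInterval, Y)} {q q' : C(Cb n, Y)} (h : Tr γ q q')
    (g : C(Y, Z)) : Tr (g.comp γ) (g.comp q) (g.comp q') := by
  obtain ⟨H, h0, h1, h2⟩ := h
  exact ⟨g.comp H, fun x => congrArg g (h0 x), fun x => congrArg g (h1 x),
    fun x hx t => congrArg g (h2 x hx t)⟩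

theorem Tr.exists_back {n : ℕ} (γ : C(unitInterval, Y)) (q : C(Cb n, Y))
    (hq : ∀ x ∈ dCb n, q x = γ 1) :
    ∃ q' : C(Cb n, Y), (∀ x ∈ dCb n, q' x = γ 0) ∧ Tr γ q' q := by
  obtain ⟨q', h, h'⟩ := exists_tr (Gaucher.rev γ) q (by simpa [Gaucher.rev] using hq)
  refine ⟨q', by simpa [Gaucher.rev] using h, ?_⟩
  have := h'.rev
  rwa [rev_rev] at this

theorem piSurj_of_path (g : C(Y, Z)) (n : ℕ) (γ : C(unitInterval, Y)) (h : PiSurj g n (γ 0)) :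
    PiSurj g n (γ 1) := by
  intro r hr
  obtain ⟨r0, hr0, T⟩ := Tr.exists_back (g.comp γ) r hr
  obtain ⟨q0, hq0, H⟩ := h r0 hr0
  obtain ⟨q1, hq1, T'⟩ := exists_tr γ q0 hq0
  exact ⟨q1, hq1, (T'.map g).hrel T H⟩

theorem piInj_of_path (g : C(Y, Z)) (n : ℕ) (γ : C(unitInterval, Y)) (h : PiInj g n (γ 0)) :
    PiInj g n (γ 1) := by
  intro q q' hq hq' H
  obtain ⟨r, hr, T⟩ := Tr.exists_back γ q hq
  obtain ⟨r', hr', T'⟩ := Tr.exists_back γ q' hq'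
  exact T.hrel T' (h r r' hr hr' ((T.map g).rev.hrel (T'.map g).rev H))

theorem WE.of_comp_right {g : C(Y, Z)} {f : C(X, Y)} (hf : WE f) (h : WE (g.comp f)) : WE g where
  surj0 z := by
    obtain ⟨x, hx⟩ := h.surj0 z
    exact ⟨f x, hx⟩
  inj0 a a' haa := by
    obtain ⟨x, hx⟩ := hf.surj0 a
    obtain ⟨x', hx'⟩ := hf.surj0 a'
    have : Joined x x' := h.inj0 _ _
      (((hx.map g.continuous).trans haa).trans (hx'.map g.continuous).symm)
    exact (hx.symm.trans (this.map f.continuous)).trans hx'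
  surj n y := by
    obtain ⟨x, ⟨p⟩⟩ := hf.surj0 y
    have : PiSurj g n (p.toContinuousMap 0) := by
      have e : p.toContinuousMap 0 = f x := p.source
      rw [e]
      intro q hq
      obtain ⟨z, hz, H⟩ := h.surj n x q hq
      exact ⟨f.comp z, fun y hy => congrArg f (hz y hy), H⟩
    have := piSurj_of_path g n p.toContinuousMap this
    have e : p.toContinuousMap 1 = y := p.target
    rwa [e] at this
  inj n y := by
    obtain ⟨x, ⟨p⟩⟩ := hf.surj0 y
    have : PiInj g n (p.toContinuousMap 0) := by
      have e : p.toContinuousMap 0 = f x := p.source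
      rw [e]
      intro q q' hq hq' H
      obtain ⟨z, hz, K⟩ := hf.surj n x q hq
      obtain ⟨z', hz', K'⟩ := hf.surj n x q' hq'
      have := h.inj n x z z' hz hz' (((K.map g).trans H).trans (K'.map g).symm)
      exact (K.symm.trans (this.map f)).trans K'
    have := piInj_of_path g n p.toContinuousMap this
    have e : p.toContinuousMap 1 = y := p.target
    rwa [e] at this

end TwoOutOfThree

theorem WE.retract {X Y Z W : Type} [TopologicalSpace X] [TopologicalSpace Y]
    [TopologicalSpace Z] [TopologicalSpace W] {f : C(X, Y)} {g : C(Z, W)}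
    (i : C(X, Z)) (r : C(Z, X)) (i' : C(Y, W)) (r' : C(W, Y))
    (h1 : ∀ x, r (i x) = x) (h2 : ∀ y, r' (i' y) = y) (h3 : ∀ x, g (i x) = i' (f x))
    (h4 : ∀ z, r' (g z) = f (r z)) (hg : WE g) : WE f where
  surj0 y := by
    obtain ⟨z, hz⟩ := hg.surj0 (i' y)
    refine ⟨r z, ?_⟩
    have := hz.map r'.continuous
    rwa [h4, h2] at this
  inj0 a a' h := by
    have := h.map i'.continuous
    rw [← h3, ← h3] at this
    have := (hg.inj0 _ _ this).map r.continuous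
    rwa [h1, h1] at this
  surj n x q hq := by
    obtain ⟨z, hz, H⟩ := hg.surj n (i x) (i'.comp q) (fun y hy => by
      rw [h3, ContinuousMap.comp_apply, hq y hy])
    refine ⟨r.comp z, fun y hy => by rw [ContinuousMap.comp_apply, hz y hy, h1], ?_⟩
    have := H.map r'
    have e1 : r'.comp (g.comp z) = f.comp (r.comp z) := by ext y; exact h4 _
    have e2 : r'.comp (i'.comp q) = q := by ext y; exact h2 _
    rwa [e1, e2] at this
  inj n x z z' hz hz' H := by
    have := H.map i'
    have e : ∀ w : C(Cb n, X), i'.comp (f.comp w) = g.comp (i.comp w) := fun w => by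
      ext y; exact (h3 _).symm
    rw [e, e] at this
    have := (hg.inj n (i x) _ _ (fun y hy => congrArg i (hz y hy))
      (fun y hy => congrArg i (hz' y hy)) this).map r
    have e : ∀ w : C(Cb n, X), r.comp (i.comp w) = w := fun w => by
      ext y; exact h1 _
    rwa [e, e] at this

/-- A strong deformation retract is a weak equivalence. -/
theorem WE.of_sdr {X Y : Type} [TopologicalSpace X] [TopologicalSpace Y] (j : C(X, Y))
    (r : C(Y, X)) (h : ∀ x, r (j x) = x) (H : C(Y × unitInterval, Y))
    (h0 : ∀ y, H (y, 0) = y) (h1 : ∀ y, H (y, 1) = j (r y)) (h2 : ∀ x t, H (j x, t) = j x) :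
    WE j where
  surj0 y := ⟨r y, Joined.symm ⟨⟨⟨fun t => H (y, t), by fun_prop⟩, h0 y, h1 y⟩⟩⟩
  inj0 a a' haa := by
    have := haa.map r.continuous
    rwa [h, h] at this
  surj n x q hq := by
    refine ⟨r.comp q, fun y hy => by rw [ContinuousMap.comp_apply, hq y hy, h], Hrel.symm ?_⟩
    refine ⟨⟨fun p => H (q p.1, p.2), by fun_prop⟩, fun x => h0 _, fun x => h1 _, ?_⟩
    intro y hy t
    show H (q y, t) = q y
    rw [hq y hy, h2]
  inj n x z z' hz hz' K := by
    have := K.map r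
    have e : ∀ w : C(Cb n, X), r.comp (j.comp w) = w := fun w => by
      ext y; exact h _
    rwa [e, e] at this

end PartB

section PartC

/-! ### Lifting properties of maps of spaces -/

/-- Right lifting property of `p` against the inclusion `K ⊆ L`. -/
def Lifts {E B : Type} [TopologicalSpace E] [TopologicalSpace B] (p : C(E, B))
    {L : Type} [TopologicalSpace L] (K : Set L) : Prop :=
  ∀ (k : C(K, E)) (b : C(L, B)), (∀ x : K, p (k x) = b x) →
    ∃ l : C(L, E), (∀ x, p (l x) = b x) ∧ ∀ x : K, l x = k x

section

variable {E B : Type} [TopologicalSpace E] [TopologicalSpace B] {p : C(E, B)}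

theorem Lifts.on {L : Type} [TopologicalSpace L] {K : Set L} (h : Lifts p K)
    (k : L → E) (hk : ContinuousOn k K) (b : C(L, B)) (hb : ∀ x ∈ K, p (k x) = b x) :
    ∃ l : C(L, E), (∀ x, p (l x) = b x) ∧ ∀ x ∈ K, l x = k x := by
  obtain ⟨l, h1, h2⟩ := h ⟨K.domRestrict k, hk.domRestrict⟩ b (fun x => hb x x.2)
  exact ⟨l, h1, fun x hx => h2 ⟨x, hx⟩⟩

theorem Lifts.of_on [Nonempty E] {L : Type} [TopologicalSpace L] {K : Set L}
    (h : ∀ (k : L → E), ContinuousOn k K → ∀ (b : C(L, B)), (∀ x ∈ K, p (k x) = b x) →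
    ∃ l : C(L, E), (∀ x, p (l x) = b x) ∧ ∀ x ∈ K, l x = k x) : Lifts p K := by
  classical
  intro k b hkb
  let k' : L → E := fun x => if hx : x ∈ K then k ⟨x, hx⟩ else Classical.arbitrary E
  have hk' : ∀ x : K, k' x = k x := fun x => by simp [k']
  have hc : K.domRestrict k' = k := funext hk'
  obtain ⟨l, h1, h2⟩ := h k' (by
    rw [continuousOn_iff_continuous_domRestrict, hc]; exact k.continuous) b (fun x hx => by
    rw [hk' ⟨x, hx⟩]; exact hkb ⟨x, hx⟩)
  exact ⟨l, h1, fun x => by rw [h2 x x.2, hk']⟩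

theorem Lifts.congr {L L' : Type} [TopologicalSpace L] [TopologicalSpace L'] {K : Set L}
    {K' : Set L'} (c : L ≃ₜ L') (hc : ∀ x, c x ∈ K' ↔ x ∈ K) (h : Lifts p K) : Lifts p K' := by
  intro k b hkb
  obtain ⟨l, h1, h2⟩ := h (k.comp ⟨fun x => ⟨c x, (hc _).2 x.2⟩, by fun_prop⟩)
    (b.comp ⟨c, c.continuous⟩) (fun x => hkb ⟨c x, (hc _).2 x.2⟩)
  refine ⟨l.comp ⟨c.symm, c.symm.continuous⟩, fun x => ?_, fun x => ?_⟩
  · have := h1 (c.symm x)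
    simpa using this
  · have := h2 ⟨c.symm x, by rw [← hc]; simp⟩
    simpa using this

open Classical in
/-- Lifts may be transported along homotopies of squares. -/
theorem Lifts.homotopy {L : Type} [TopologicalSpace L] {K : Set L} (hK : IsClosed K)
    (h : Lifts p (box K)) (A : L × unitInterval → E) (hA : ContinuousOn A {q | q.1 ∈ K})
    (b : C(L × unitInterval, B)) (hAb : ∀ x ∈ K, ∀ t, p (A (x, t)) = b (x, t))
    (l : C(L, E)) (hl : ∀ x, p (l x) = b (x, 1)) (hlA : ∀ x ∈ K, l x = A (x, 1)) :
    ∃ l : C(L, E), (∀ x, p (l x) = b (x, 0)) ∧ ∀ x ∈ K, l x = A (x, 0) := by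
  let k : L × unitInterval → E := fun q =>
    if q.1 ∈ K then A (q.1, unitInterval.symm q.2) else l q.1
  have k1 : ∀ x ∈ K, ∀ t, k (x, t) = A (x, unitInterval.symm t) := fun x hx t => by simp [k, hx]
  have k2 : ∀ x, k (x, 0) = l x := fun x => by
    by_cases hx : x ∈ K
    · rw [k1 x hx, hlA x hx, unitInterval.symm_zero]
    · simp [k, hx]
  obtain ⟨m, h1, h2⟩ := h.on k (by
      refine continuousOn_glue (isClosed_singleton.preimage continuous_snd)
        (hK.preimage continuous_fst) (f := fun p => l p.1)
        (g := fun p => A (p.1, unitInterval.symm p.2)) (by fun_prop) ?_ ?_ ?_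
      · exact hA.comp (by fun_prop) (fun x hx => hx)
      · rintro ⟨x, t⟩ (rfl : t = 0); exact k2 x
      · rintro ⟨x, t⟩ hx; exact k1 x hx t)
    (b.comp ⟨fun q => (q.1, unitInterval.symm q.2), by fun_prop⟩) (by
      rintro ⟨x, t⟩ (ht | hx)
      · obtain rfl : t = 0 := ht
        rw [k2, hl]
        simp
      · rw [k1 x hx, hAb x hx]; rfl)
  refine ⟨⟨fun x => m (x, 1), by fun_prop⟩, fun x => ?_, fun x hx => ?_⟩
  · have := h1 (x, 1)
    simpa using this
  · have := h2 (x, 1) (Or.inr hx)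
    rw [k1 x hx] at this
    simpa using this

end

section Main

variable {E B : Type} [TopologicalSpace E] [TopologicalSpace B] {p : C(E, B)}

theorem box_cb_succ (hJ : ∀ n, Lifts p (box (dCb n))) (n : ℕ) :
    Lifts p (box (bdry (dCb n))) :=
  (hJ (n + 1)).congr ((cbHomeo n).symm.prodCongr (Homeomorph.refl unitInterval)) (by
    rintro ⟨y, t⟩
    obtain ⟨x, rfl⟩ := (cbHomeo n).surjective y
    show t = 0 ∨ (cbHomeo n).symm (cbHomeo n x) ∈ bdry (dCb n) ↔ t = 0 ∨ cbHomeo n x ∈ dCb (n + 1)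
    rw [cbHomeo_mem, Homeomorph.symm_apply_apply])

/-- Step 3: constant on the boundary. -/
theorem lift_step3 (hJ : ∀ n, Lifts p (box (dCb n))) (hp : WE p) (n : ℕ) (e : E)
    (b : C(Cb n × unitInterval, B)) (hb : ∀ x ∈ bdry (dCb n), b x = p e) :
    ∃ l : C(Cb n × unitInterval, E), (∀ x, p (l x) = b x) ∧ ∀ x ∈ bdry (dCb n), l x = e := by
  obtain ⟨z, hz, H⟩ := hp.surj (n + 1) e (b.comp ⟨(cbHomeo n).symm, (cbHomeo n).symm.continuous⟩)
    (by
      intro y hy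
      obtain ⟨x, rfl⟩ := (cbHomeo n).surjective y
      rw [cbHomeo_mem] at hy
      simpa using hb x hy)
  obtain ⟨H, h0, h1, h2⟩ := H.symm
  have := (box_cb_succ hJ n).homotopy (isClosed_bdry (isBall_cb n).isClosed) (fun _ => e)
    (by fun_prop) (H.comp ⟨fun q => (cbHomeo n q.1, q.2), by fun_prop⟩) (by
      intro x hx t
      have := h2 (cbHomeo n x) ((cbHomeo_mem n x).2 hx) t
      simp only [ContinuousMap.comp_apply, ContinuousMap.coe_mk, this,
        Homeomorph.symm_apply_apply, hb x hx])
    (z.comp ⟨cbHomeo n, (cbHomeo n).continuous⟩) (by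
      intro x
      simp [h1]) (by
      intro x hx
      exact hz _ ((cbHomeo_mem n x).2 hx))
  obtain ⟨l, hl, hl'⟩ := this
  refine ⟨l, fun x => ?_, hl'⟩
  rw [hl]
  simp [h0]

/-- Step 2: constant on the open box. -/
theorem lift_step2 (hJ : ∀ n, Lifts p (box (dCb n))) (hp : WE p) (n : ℕ) (e : E)
    (k : Cb n × unitInterval → E) (hk : ContinuousOn k (bdry (dCb n)))
    (hke : ∀ x ∈ box (dCb n), k x = e)
    (b : C(Cb n × unitInterval, B)) (hb : ∀ x ∈ bdry (dCb n), p (k x) = b x) :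
    ∃ l : C(Cb n × unitInterval, E), (∀ x, p (l x) = b x) ∧ ∀ x ∈ bdry (dCb n), l x = k x := by
  let α : C(Cb n, E) := ⟨fun x => k (x, 1), hk.comp_continuous (by fun_prop) fun x => Or.inl rfl⟩
  obtain ⟨H, h0, h1, h2⟩ := hp.inj n e (ContinuousMap.const _ e) α (fun _ _ => rfl)
    (fun y hy => hke _ (Or.inr hy)) ⟨b, fun x => by
      rw [← hb _ (Or.inr (Or.inl rfl)), hke _ (Or.inl rfl)]; rfl, fun x => by
      rw [← hb _ (Or.inl rfl)]; rfl, fun x hx t => by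
      rw [← hb _ (Or.inr (Or.inr hx)), hke _ (Or.inr hx)]; rfl⟩
  have hcl := isClosed_bdry (isBall_cb n).isClosed
  let A : C((Cb n × unitInterval) × unitInterval, E) :=
    H.comp ⟨fun q => (q.1.1, q.1.2 * unitInterval.symm q.2), by fun_prop⟩
  have A0 : ∀ x ∈ bdry (dCb n), A (x, 0) = k x := by
    rintro ⟨x, t⟩ (h | h | h)
    · obtain rfl : t = 1 := h
      simp [A, h1, α]
    · obtain rfl : t = 0 := h
      rw [hke _ (Or.inl rfl)]
      simp [A, h0]
    · rw [hke _ (Or.inr h)]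
      show H (x, _) = e
      rw [h2 x h]; rfl
  obtain ⟨b', hb0, hb1⟩ := (isBall_cb n).bdry.hep.extend' hcl b (p.comp A) (by fun_prop) (by
    intro x hx
    rw [ContinuousMap.comp_apply, A0 x hx, hb x hx])
  have A1 : ∀ x, A (x, 1) = e := fun x => by
    simp [A, h0]
  obtain ⟨l, hl, hl'⟩ := lift_step3 hJ hp n e (b'.comp ⟨fun x => (x, 1), by fun_prop⟩) (by
    intro x hx
    show b' (x, 1) = p e
    rw [hb1 x hx, ContinuousMap.comp_apply, A1])
  obtain ⟨m, hm, hm'⟩ := (box_cb_succ hJ n).homotopy hcl A (by fun_prop) b'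
    (fun x hx t => (hb1 x hx t).symm) l hl (fun x hx => by rw [hl' x hx, A1])
  exact ⟨m, fun x => by rw [hm, hb0], fun x hx => by rw [hm' x hx, A0 x hx]⟩

open Classical in
/-- Step 1: the general case. -/
theorem lift_step1 (hJ : ∀ n, Lifts p (box (dCb n))) (hp : WE p) (n : ℕ)
    (k : Cb n × unitInterval → E) (hk : ContinuousOn k (bdry (dCb n)))
    (b : C(Cb n × unitInterval, B)) (hb : ∀ x ∈ bdry (dCb n), p (k x) = b x) :
    ∃ l : C(Cb n × unitInterval, E), (∀ x, p (l x) = b x) ∧ ∀ x ∈ bdry (dCb n), l x = k x := by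
  have hcl0 := (isBall_cb n).isClosed
  have hcl := isClosed_bdry hcl0
  obtain ⟨κ, hκ⟩ := (isBall_cb n).hep.extend k (hk.mono fun x hx => Or.inr hx)
  let G : C((Cb n × unitInterval) × unitInterval, E) :=
    κ.comp ⟨fun q => (fun i => unitInterval.symm q.2 * q.1.1 i, unitInterval.symm q.2 * q.1.2),
      by fun_prop⟩
  have G0 : ∀ x, G (x, 0) = κ x := fun x => by simp [G]
  have G1 : ∀ x, G (x, 1) = κ (fun _ => 0, 0) := fun x => by simp [G]
  obtain ⟨T, T0, T1⟩ := (isBall_cb n).hep.extend' hcl0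
    ⟨fun x => k (x, 1), hk.comp_continuous (by fun_prop) fun x => Or.inl rfl⟩
    (fun q => G ((q.1, 1), q.2)) (by fun_prop) (by
      intro x hx
      rw [G0, hκ _ (Or.inr hx)]; rfl)
  let A : (Cb n × unitInterval) × unitInterval → E := fun q =>
    if q.1.2 = 1 then T (q.1.1, q.2) else G q
  have AT : ∀ x u, A ((x, 1), u) = T (x, u) := fun x u => by simp [A]
  have AG : ∀ x ∈ box (dCb n), ∀ u, A (x, u) = G (x, u) := by
    rintro ⟨x, t⟩ hx u
    by_cases ht : t = 1
    · subst ht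
      rw [AT]
      rcases hx with h | h
      · exact absurd h one_ne_zero
      · exact T1 x h u
    · simp [A, ht]
  have Ac : ContinuousOn A {q | q.1 ∈ bdry (dCb n)} := by
    have c1 : IsClosed {p : (Cb n × unitInterval) × unitInterval | p.1.2 = 1} :=
      isClosed_singleton.preimage (continuous_snd.comp continuous_fst)
    have c2 : IsClosed {p : (Cb n × unitInterval) × unitInterval | p.1 ∈ box (dCb n)} :=
      (isClosed_box hcl0).preimage continuous_fst
    refine continuousOn_glue c1 c2 (f := fun q => T (q.1.1, q.2)) (g := G) (by fun_prop)
      (by fun_prop) ?_ ?_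
    · rintro ⟨⟨x, t⟩, u⟩ (rfl : t = 1); exact AT x u
    · rintro ⟨x, u⟩ hx; exact AG x hx u
  have A0 : ∀ x ∈ bdry (dCb n), A (x, 0) = k x := by
    rintro ⟨x, t⟩ (h | h)
    · obtain rfl : t = 1 := h
      rw [AT, T0]; rfl
    · rw [AG _ h, G0, hκ _ h]
  obtain ⟨b', hb0, hb1⟩ := (isBall_cb n).bdry.hep.extend' hcl b (fun q => p (A q))
    (p.continuous.comp_continuousOn Ac) (by
    intro x hx
    rw [A0 x hx, hb x hx])
  obtain ⟨l, hl, hl'⟩ := lift_step2 hJ hp n (κ (fun _ => 0, 0)) (fun x => A (x, 1))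
    (Ac.comp (by fun_prop) fun x hx => hx) (fun x hx => by rw [AG x hx, G1])
    (b'.comp ⟨fun x => (x, 1), by fun_prop⟩) (fun x hx => (hb1 x hx 1).symm)
  obtain ⟨m, hm, hm'⟩ := (box_cb_succ hJ n).homotopy hcl A Ac b'
    (fun x hx t => (hb1 x hx t).symm) l hl hl'
  exact ⟨m, fun x => by rw [hm, hb0], fun x hx => by rw [hm' x hx, A0 x hx]⟩

theorem lifts_bdry (hJ : ∀ n, Lifts p (box (dCb n))) (hp : WE p) (n : ℕ) :
    Lifts p (bdry (dCb n)) := by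
  intro k b hkb
  have : Nonempty E := ⟨k ⟨(fun _ => 0, 0), Or.inr (Or.inl rfl)⟩⟩
  exact Lifts.of_on (lift_step1 hJ hp n) k b hkb

theorem lifts_dCb (hJ : ∀ n, Lifts p (box (dCb n))) (hp : WE p) (n : ℕ) :
    Lifts p (dCb n) := by
  cases n with
  | succ n => exact (lifts_bdry hJ hp n).congr (cbHomeo n) (cbHomeo_mem n)
  | zero =>
    intro k b hkb
    obtain ⟨a, ⟨γ⟩⟩ := hp.surj0 (b 0)
    obtain ⟨l, hl, hl'⟩ := (hJ 0).on (fun _ => a) (by fun_prop)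
      ⟨fun q => γ q.2, by fun_prop⟩ (by
        rintro ⟨x, t⟩ (h | ⟨i, _⟩)
        · obtain rfl : t = 0 := h
          simp
        · exact i.elim0)
    refine ⟨⟨fun x => l (x, 1), by fun_prop⟩, fun x => ?_, ?_⟩
    · have := hl (x, 1)
      simp only [ContinuousMap.coe_mk, Path.target] at this ⊢
      rw [this]; congr 1; exact Subsingleton.elim _ _
    · rintro ⟨x, i, _⟩; exact i.elim0

open Classical in
theorem WE.of_lifts (h1 : ∀ n, Lifts p (dCb n)) (h2 : ∀ n, Lifts p (bdry (dCb n))) : WE p where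
  surj0 b := by
    obtain ⟨l, hl, -⟩ := h1 0 ⟨fun x => (by obtain ⟨x, i, _⟩ := x; exact i.elim0 : False).elim, by
      have : IsEmpty (dCb 0) := ⟨by rintro ⟨x, i, _⟩; exact i.elim0⟩
      exact continuous_of_isEmpty _⟩ (ContinuousMap.const _ b)
      (by rintro ⟨x, i, _⟩; exact i.elim0)
    refine ⟨l 0, ?_⟩
    rw [hl]; exact Joined.refl _
  inj0 a a' := by
    rintro ⟨γ⟩
    obtain ⟨l, hl, hl'⟩ := (h2 0).on (fun q => if q.2 = 1 then a' else a) (by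
        refine continuousOn_glue (isClosed_singleton.preimage continuous_snd)
          (isClosed_box (isBall_cb 0).isClosed) (f := fun p => a') (g := fun p => a) (by fun_prop)
          (by fun_prop) ?_ ?_
        · rintro ⟨x, t⟩ (h : t = 1); simp [h]
        · rintro ⟨x, t⟩ ((h : t = 0) | ⟨i, _⟩)
          · simp [h]
          · exact i.elim0) ⟨fun q => γ q.2, by fun_prop⟩ (by
        rintro ⟨x, t⟩ ((h : t = 1) | (h : t = 0) | ⟨i, _⟩)
        · simp [h]
        · simp [h]
        · exact i.elim0)
    refine ⟨⟨⟨fun t => l (0, t), by fun_prop⟩, ?_, ?_⟩⟩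
    · have := hl' (0, 0) (Or.inr (Or.inl rfl))
      simpa using this
    · have := hl' (0, 1) (Or.inl rfl)
      simpa using this
  surj n x q hq := by
    obtain ⟨l, hl, hl'⟩ := (h1 n).on (fun _ => x) (by fun_prop) q (fun y hy => (hq y hy).symm)
    refine ⟨l, hl', ?_⟩
    have : p.comp l = q := by ext y; exact hl y
    rw [this]; exact Hrel.refl q
  inj n x z z' hz hz' := by
    rintro ⟨H, e0, e1, e2⟩
    let k : Cb n × unitInterval → E := fun q => if q.2 = 1 then z' q.1 else z q.1
    have k1 : ∀ x, k (x, 1) = z' x := fun x => by simp [k]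
    have k2 : ∀ x ∈ box (dCb n), k x = z x.1 := by
      rintro ⟨y, t⟩ hx
      by_cases ht : t = 1
      · subst ht
        rw [k1]
        rcases hx with h | h
        · exact absurd h one_ne_zero
        · rw [hz' y h, hz y h]
      · simp [k, ht]
    obtain ⟨l, hl, hl'⟩ := (h2 n).on k (by
        refine continuousOn_glue (isClosed_singleton.preimage continuous_snd)
          (isClosed_box (isBall_cb n).isClosed) (f := fun q => z' q.1) (g := fun q => z q.1)
          (by fun_prop) (by fun_prop) ?_ ?_
        · rintro ⟨y, t⟩ (h : t = 1); subst h; exact k1 y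
        · exact k2) H (by
        rintro ⟨y, t⟩ ((h : t = 1) | (h : t = 0) | h)
        · subst h; rw [k1, e1]; rfl
        · subst h; rw [k2 _ (Or.inl rfl), e0]; rfl
        · rw [k2 _ (Or.inr h), e2 y h]; rfl)
    refine ⟨l, fun y => ?_, fun y => ?_, fun y hy t => ?_⟩
    · rw [hl' _ (Or.inr (Or.inl rfl)), k2 _ (Or.inl rfl)]
    · rw [hl' _ (Or.inl rfl), k1]
    · rw [hl' _ (Or.inr (Or.inr hy)), k2 _ (Or.inr hy)]

end Main

end PartC

section PartD

/-! ### Limits of flows -/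

theorem Flow.continuous_s (X : Flow) : Continuous X.s :=
  continuous_discrete_rng.2 X.isOpen_preimage_s

theorem Flow.continuous_t (X : Flow) : Continuous X.t :=
  continuous_discrete_rng.2 X.isOpen_preimage_t

theorem Flow.comp_congr (X : Flow) {x x' y y' : X.Path} (h : X.t x = X.s y) (hx : x = x')
    (hy : y = y') : X.comp x y h = X.comp x' y' (by rw [← hx, ← hy, h]) := by
  subst hx hy; rfl

theorem Flow.continuous_comp' (X : Flow) {W : Type*} [TopologicalSpace W] {f g : W → X.Path}
    (hf : Continuous f) (hg : Continuous g) (h : ∀ w, X.t (f w) = X.s (g w)) :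
    Continuous fun w => X.comp (f w) (g w) (h w) :=
  X.continuous_comp.comp ((hf.prodMk hg).subtype_mk h)

section Limits

variable {J : Type} [SmallCategory J] (F : J ⥤ Flow)

/-- States of the limit. -/
structure LimS : Type where
  val : ∀ j, (F.obj j).State
  prop : ∀ ⦃j k : J⦄ (φ : j ⟶ k), FlowHom.toFun0 (F.map φ) (val j) = val k

/-- Paths of the limit. -/
structure LimP : Type where
  val : ∀ j, (F.obj j).Path
  prop : ∀ ⦃j k : J⦄ (φ : j ⟶ k), FlowHom.toFunP (F.map φ) (val j) = val k

variable {F} in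
theorem LimS.ext' {x y : LimS F} (h : x.val = y.val) : x = y := by
  cases x; cases y; cases h; rfl

variable {F} in
theorem LimP.ext' {x y : LimP F} (h : x.val = y.val) : x = y := by
  cases x; cases y; cases h; rfl

/-- Source map of the limit. -/
def limSrc (p : LimP F) : LimS F :=
  ⟨fun j => (F.obj j).s (p.1 j), fun j k φ => by
    rw [← FlowHom.s_map, p.2]⟩

/-- Target map of the limit. -/
def limTgt (p : LimP F) : LimS F :=
  ⟨fun j => (F.obj j).t (p.1 j), fun j k φ => by
    rw [← FlowHom.t_map, p.2]⟩

instance : TopologicalSpace (LimS F) := ⊥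
instance : DiscreteTopology (LimS F) := ⟨rfl⟩

instance : TopologicalSpace (LimP F) :=
  TopologicalSpace.induced (fun p => (p.1, limSrc F p, limTgt F p)) inferInstance

theorem continuous_limP {W : Type*} [TopologicalSpace W] {f : W → LimP F}
    (h : ∀ j, Continuous fun w => (f w).1 j) (hs : Continuous fun w => limSrc F (f w))
    (ht : Continuous fun w => limTgt F (f w)) : Continuous f :=
  continuous_induced_rng.2 ((continuous_pi h).prodMk (hs.prodMk ht))

theorem limP_cont : Continuous (fun p : LimP F => (p.1, limSrc F p, limTgt F p)) :=
  continuous_induced_dom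

theorem limP_cont_val (j : J) : Continuous (fun p : LimP F => p.1 j) :=
  (continuous_apply j).comp (continuous_fst.comp (limP_cont F))

theorem limSrc_cont : Continuous (limSrc F) :=
  continuous_fst.comp (continuous_snd.comp (limP_cont F))

theorem limTgt_cont : Continuous (limTgt F) :=
  continuous_snd.comp (continuous_snd.comp (limP_cont F))

/-- The limit flow. -/
def limFlow : Flow where
  State := LimS F
  Path := LimP F
  s := limSrc F
  t := limTgt F
  isOpen_preimage_s a := (isOpen_discrete {a}).preimage (limSrc_cont F)
  isOpen_preimage_t a := (isOpen_discrete {a}).preimage (limTgt_cont F)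
  comp x y h := ⟨fun j => (F.obj j).comp (x.1 j) (y.1 j) (congrFun (congrArg LimS.val h) j), by
    intro j k φ
    have hh : (F.obj k).t (FlowHom.toFunP (F.map φ) (x.1 j)) =
        (F.obj k).s (FlowHom.toFunP (F.map φ) (y.1 j)) := by
      rw [x.2, y.2]; exact congrFun (congrArg LimS.val h) k
    exact (FlowHom.comp_map (F.map φ) _ _ _ hh).trans
      (Flow.comp_congr _ _ (x.2 φ) (y.2 φ))⟩
  continuous_comp := by
    refine continuous_limP F (fun j => ?_) ?_ ?_
    · exact Flow.continuous_comp' _ ((limP_cont_val F j).comp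
        (continuous_fst.comp continuous_subtype_val)) ((limP_cont_val F j).comp
        (continuous_snd.comp continuous_subtype_val)) _
    · refine ((limSrc_cont F).comp (continuous_fst.comp continuous_subtype_val)).congr ?_
      intro p
      exact LimS.ext' (funext fun j => ((F.obj j).s_comp _ _ _).symm)
    · refine ((limTgt_cont F).comp (continuous_snd.comp continuous_subtype_val)).congr ?_
      intro p
      exact LimS.ext' (funext fun j => ((F.obj j).t_comp _ _ _).symm)
  s_comp x y h := LimS.ext' (funext fun j => (F.obj j).s_comp _ _ _)
  t_comp x y h := LimS.ext' (funext fun j => (F.obj j).t_comp _ _ _)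
  comp_assoc x y z h h' h1 h2 := LimP.ext' (funext fun j => (F.obj j).comp_assoc _ _ _ _ _ _ _)

/-- The projections of the limit flow. -/
def limProj (j : J) : FlowHom (limFlow F) (F.obj j) where
  toFun0 x := x.1 j
  toFunP x := x.1 j
  continuous_toFunP := limP_cont_val F j
  s_map x := rfl
  t_map x := rfl
  comp_map x y h h' := rfl

/-- The limit cone. -/
def limCone : Limits.Cone F where
  pt := limFlow F
  π :=
    { app := fun j => limProj F j
      naturality := fun j k φ => FlowHom.ext (funext fun x => (x.2 φ).symm)
        (funext fun x => (x.2 φ).symm) }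

theorem cone_w0 (c : Limits.Cone F) {j k : J} (φ : j ⟶ k) (x : c.pt.State) :
    FlowHom.toFun0 (F.map φ) (FlowHom.toFun0 (c.π.app j) x) = FlowHom.toFun0 (c.π.app k) x :=
  congrFun (congrArg FlowHom.toFun0 (c.w φ)) x

theorem cone_wP (c : Limits.Cone F) {j k : J} (φ : j ⟶ k) (x : c.pt.Path) :
    FlowHom.toFunP (F.map φ) (FlowHom.toFunP (c.π.app j) x) = FlowHom.toFunP (c.π.app k) x :=
  congrFun (congrArg FlowHom.toFunP (c.w φ)) x

/-- The universal map to the limit. -/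
def limLift (c : Limits.Cone F) : FlowHom c.pt (limFlow F) where
  toFun0 x := ⟨fun j => FlowHom.toFun0 (c.π.app j) x, fun j k φ => cone_w0 F c φ x⟩
  toFunP x := ⟨fun j => FlowHom.toFunP (c.π.app j) x, fun j k φ => cone_wP F c φ x⟩
  continuous_toFunP := by
    refine continuous_limP F (fun j => FlowHom.continuous_toFunP (c.π.app j)) ?_ ?_
    · let f : c.pt.State → LimS F :=
        fun x => ⟨fun j => FlowHom.toFun0 (c.π.app j) x, fun j k φ => cone_w0 F c φ x⟩
      refine ((continuous_of_discreteTopology (f := f)).comp c.pt.continuous_s).congr fun x => ?_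
      exact LimS.ext' (funext fun j => (FlowHom.s_map (c.π.app j) x).symm)
    · let f : c.pt.State → LimS F :=
        fun x => ⟨fun j => FlowHom.toFun0 (c.π.app j) x, fun j k φ => cone_w0 F c φ x⟩
      refine ((continuous_of_discreteTopology (f := f)).comp c.pt.continuous_t).congr fun x => ?_
      exact LimS.ext' (funext fun j => (FlowHom.t_map (c.π.app j) x).symm)
  s_map x := LimS.ext' (funext fun j => FlowHom.s_map (c.π.app j) x)
  t_map x := LimS.ext' (funext fun j => FlowHom.t_map (c.π.app j) x)
  comp_map x y h h' := LimP.ext' (funext fun j => FlowHom.comp_map (c.π.app j) x y h _)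

/-- The limit cone is a limit. -/
def limIsLimit : Limits.IsLimit (limCone F) where
  lift c := limLift F c
  fac c j := rfl
  uniq c m hm := FlowHom.ext
    (funext fun x => LimS.ext' (funext fun j =>
      congrFun (congrArg FlowHom.toFun0 (hm j)) x))
    (funext fun x => LimP.ext' (funext fun j =>
      congrFun (congrArg FlowHom.toFunP (hm j)) x))

end Limits

theorem hasLimits_flow : Limits.HasLimits Flow :=
  ⟨fun _ _ => ⟨fun F => ⟨⟨limCone F, limIsLimit F⟩⟩⟩⟩

/-! ### Colimits of flows -/

section Colimits

variable {J : Type} [SmallCategory J] (F : J ⥤ Flow)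

/-- States of the colimit. -/
def ColS : Type := Quot (fun x y : Σ j, (F.obj j).State =>
  ∃ φ : x.1 ⟶ y.1, y.2 = FlowHom.toFun0 (F.map φ) x.2)

instance : TopologicalSpace (ColS F) := ⊥
instance : DiscreteTopology (ColS F) := ⟨rfl⟩

/-- The class of a state. -/
def cls (j : J) (x : (F.obj j).State) : ColS F := Quot.mk _ ⟨j, x⟩

theorem cls_map {j k : J} (φ : j ⟶ k) (x : (F.obj j).State) :
    cls F k (FlowHom.toFun0 (F.map φ) x) = cls F j x :=
  (Quot.sound ⟨φ, rfl⟩).symm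

/-- Formal composites of paths. -/
inductive Pre : ColS F → ColS F → Type
  | of {a b : ColS F} (j : J) (p : (F.obj j).Path) (ha : cls F j ((F.obj j).s p) = a)
      (hb : cls F j ((F.obj j).t p) = b) : Pre a b
  | comp {a b b' c : ColS F} (h : b = b') (x : Pre a b) (y : Pre b' c) : Pre a c

variable {F}

theorem cocone_w0 (c : Limits.Cocone F) {j k : J} (φ : j ⟶ k) (x : (F.obj j).State) :
    FlowHom.toFun0 (c.ι.app k) (FlowHom.toFun0 (F.map φ) x) = FlowHom.toFun0 (c.ι.app j) x :=
  congrFun (congrArg FlowHom.toFun0 (c.w φ)) x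

theorem cocone_wP (c : Limits.Cocone F) {j k : J} (φ : j ⟶ k) (x : (F.obj j).Path) :
    FlowHom.toFunP (c.ι.app k) (FlowHom.toFunP (F.map φ) x) = FlowHom.toFunP (c.ι.app j) x :=
  congrFun (congrArg FlowHom.toFunP (c.w φ)) x

/-- Evaluation of states in a cocone. -/
def evalS (c : Limits.Cocone F) : ColS F → c.pt.State :=
  Quot.lift (fun x => FlowHom.toFun0 (c.ι.app x.1) x.2) (by
    rintro ⟨j, x⟩ ⟨k, y⟩ ⟨φ, h⟩
    simp only at h φ
    subst h
    exact (cocone_w0 c φ x).symm)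

/-- Evaluation of formal composites in a cocone. -/
def evalPre (c : Limits.Cocone F) : ∀ {a b : ColS F}, Pre F a b →
    {q : c.pt.Path // c.pt.s q = evalS c a ∧ c.pt.t q = evalS c b}
  | _, _, .of j p ha hb => ⟨FlowHom.toFunP (c.ι.app j) p, by
      rw [FlowHom.s_map, ← ha]; rfl, by rw [FlowHom.t_map, ← hb]; rfl⟩
  | _, _, .comp h x y => ⟨c.pt.comp (evalPre c x).1 (evalPre c y).1 (by
      rw [(evalPre c x).2.2, (evalPre c y).2.1, h]), by
      rw [c.pt.s_comp, (evalPre c x).2.1], by rw [c.pt.t_comp, (evalPre c y).2.2]⟩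

variable (F)

/-- Formal composites with arbitrary end points. -/
structure PrePath : Type where
  a : ColS F
  b : ColS F
  pre : Pre F a b

/-- Formal composites are identified if they agree in all cocones. -/
instance colSetoid : Setoid (PrePath F) where
  r x y := x.a = y.a ∧ x.b = y.b ∧
    ∀ c : Limits.Cocone F, (evalPre c x.pre).1 = (evalPre c y.pre).1
  iseqv := ⟨fun x => ⟨rfl, rfl, fun _ => rfl⟩, fun h => ⟨h.1.symm, h.2.1.symm, fun c => (h.2.2 c).symm⟩,
    fun h h' => ⟨h.1.trans h'.1, h.2.1.trans h'.2.1, fun c => (h.2.2 c).trans (h'.2.2 c)⟩⟩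

/-- Paths of the colimit. -/
structure ColP : Type where
  /-- the class -/
  q : Quotient (colSetoid F)

variable {F} in
/-- Constructor. -/
def ColP.of (x : PrePath F) : ColP F := ⟨Quotient.mk _ x⟩

variable {F} in
theorem ColP.ind {P : ColP F → Prop} (h : ∀ x, P (ColP.of x)) (x : ColP F) : P x := by
  obtain ⟨x⟩ := x
  induction x using Quotient.inductionOn with
  | _ x => exact h x

variable {F}

/-- Source. -/
def colSrc (x : ColP F) : ColS F := Quotient.lift (s := colSetoid F) PrePath.a (fun _ _ h => h.1) x.q
/-- Target. -/
def colTgt (x : ColP F) : ColS F := Quotient.lift (s := colSetoid F) PrePath.b (fun _ _ h => h.2.1) x.q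
/-- Evaluation of paths in a cocone. -/
def evalP (c : Limits.Cocone F) (x : ColP F) : c.pt.Path :=
  Quotient.lift (s := colSetoid F) (fun x : PrePath F => (evalPre c x.pre).1)
    (fun _ _ h => h.2.2 c) x.q

theorem ColP.ext {x y : ColP F} (hs : colSrc x = colSrc y) (ht : colTgt x = colTgt y)
    (h : ∀ c, evalP c x = evalP c y) : x = y := by
  induction x using ColP.ind with
  | _ x =>
  induction y using ColP.ind with
  | _ y => exact congrArg ColP.mk (Quotient.sound ⟨hs, ht, h⟩)

theorem s_evalP (c : Limits.Cocone F) (x : ColP F) : c.pt.s (evalP c x) = evalS c (colSrc x) := by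
  induction x using ColP.ind with
  | _ x => exact (evalPre c x.pre).2.1

theorem t_evalP (c : Limits.Cocone F) (x : ColP F) : c.pt.t (evalP c x) = evalS c (colTgt x) := by
  induction x using ColP.ind with
  | _ x => exact (evalPre c x.pre).2.2

theorem exists_colComp (x y : ColP F) (h : colTgt x = colSrc y) :
    ∃ z : ColP F, colSrc z = colSrc x ∧ colTgt z = colTgt y ∧
      ∀ c (h' : c.pt.t (evalP c x) = c.pt.s (evalP c y)),
        evalP c z = c.pt.comp (evalP c x) (evalP c y) h' := by
  induction x using ColP.ind with
  | _ x =>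
  induction y using ColP.ind with
  | _ y =>
    exact ⟨ColP.of ⟨x.a, y.b, Pre.comp h x.pre y.pre⟩, rfl, rfl, fun c h' => rfl⟩

/-- Composition of paths. -/
noncomputable def colComp (x y : ColP F) (h : colTgt x = colSrc y) : ColP F :=
  (exists_colComp x y h).choose

theorem s_colComp (x y : ColP F) (h : colTgt x = colSrc y) : colSrc (colComp x y h) = colSrc x :=
  (exists_colComp x y h).choose_spec.1

theorem t_colComp (x y : ColP F) (h : colTgt x = colSrc y) : colTgt (colComp x y h) = colTgt y :=
  (exists_colComp x y h).choose_spec.2.1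

theorem evalP_colComp (c : Limits.Cocone F) (x y : ColP F) (h : colTgt x = colSrc y)
    (h' : c.pt.t (evalP c x) = c.pt.s (evalP c y)) :
    evalP c (colComp x y h) = c.pt.comp (evalP c x) (evalP c y) h' :=
  (exists_colComp x y h).choose_spec.2.2 c h'

instance : TopologicalSpace (ColP F) :=
  TopologicalSpace.induced (fun p => ((fun c : Limits.Cocone F => evalP c p), colSrc p, colTgt p))
    inferInstance

theorem continuous_colP {W : Type*} [TopologicalSpace W] {f : W → ColP F}
    (h : ∀ c, Continuous fun w => evalP c (f w)) (hs : Continuous fun w => colSrc (f w))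
    (ht : Continuous fun w => colTgt (f w)) : Continuous f :=
  continuous_induced_rng.2 ((continuous_pi h).prodMk (hs.prodMk ht))

theorem colP_cont : Continuous
    (fun p : ColP F => ((fun c : Limits.Cocone F => evalP c p), colSrc p, colTgt p)) :=
  continuous_induced_dom

theorem continuous_evalP (c : Limits.Cocone F) : Continuous (evalP c) :=
  (continuous_apply c).comp (continuous_fst.comp colP_cont)

theorem continuous_colSrc : Continuous (colSrc (F := F)) :=
  continuous_fst.comp (continuous_snd.comp colP_cont)

theorem continuous_colTgt : Continuous (colTgt (F := F)) :=
  continuous_snd.comp (continuous_snd.comp colP_cont)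

variable (F)

/-- The colimit flow. -/
noncomputable def colFlow : Flow where
  State := ColS F
  Path := ColP F
  s := colSrc
  t := colTgt
  isOpen_preimage_s a := (isOpen_discrete {a}).preimage continuous_colSrc
  isOpen_preimage_t a := (isOpen_discrete {a}).preimage continuous_colTgt
  comp := colComp
  continuous_comp := by
    refine continuous_colP (fun c => ?_) ?_ ?_
    · have hh : ∀ p : { p : ColP F × ColP F // colTgt p.1 = colSrc p.2 },
          c.pt.t (evalP c p.1.1) = c.pt.s (evalP c p.1.2) := fun p => by
        rw [s_evalP, t_evalP, p.2]
      refine (Flow.continuous_comp' c.pt ((continuous_evalP c).comp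
        (continuous_fst.comp continuous_subtype_val)) ((continuous_evalP c).comp
        (continuous_snd.comp continuous_subtype_val)) hh).congr fun p => ?_
      exact (evalP_colComp c _ _ p.2 (hh p)).symm
    · refine (continuous_colSrc.comp (continuous_fst.comp continuous_subtype_val)).congr ?_
      intro p
      exact (s_colComp _ _ p.2).symm
    · refine (continuous_colTgt.comp (continuous_snd.comp continuous_subtype_val)).congr ?_
      intro p
      exact (t_colComp _ _ p.2).symm
  s_comp := s_colComp
  t_comp := t_colComp
  comp_assoc x y z hxy hyz h1 h2 := by
    refine ColP.ext ?_ ?_ fun c => ?_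
    · simp only [s_colComp]
    · simp only [t_colComp]
    · have e : ∀ {x y : ColP F}, colTgt x = colSrc y → c.pt.t (evalP c x) = c.pt.s (evalP c y) :=
        fun h => by rw [s_evalP, t_evalP, h]
      rw [evalP_colComp c _ _ h1 (e h1), evalP_colComp c _ _ h2 (e h2)]
      rw [Flow.comp_congr _ _ rfl (evalP_colComp c y z hyz (e hyz)),
        Flow.comp_congr _ (e h2) (evalP_colComp c x y hxy (e hxy)) rfl]
      exact c.pt.comp_assoc _ _ _ _ _ _ _

/-- The inclusions in the colimit. -/
noncomputable def colIncl (j : J) : FlowHom (F.obj j) (colFlow F) where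
  toFun0 := cls F j
  toFunP p := ColP.of ⟨_, _, Pre.of j p rfl rfl⟩
  continuous_toFunP := continuous_colP (fun c => FlowHom.continuous_toFunP (c.ι.app j))
    ((continuous_of_discreteTopology (f := cls F j)).comp (F.obj j).continuous_s)
    ((continuous_of_discreteTopology (f := cls F j)).comp (F.obj j).continuous_t)
  s_map x := rfl
  t_map x := rfl
  comp_map x y h h'' := by
    have h' : colTgt (ColP.of ⟨_, _, Pre.of j x rfl rfl⟩) =
      colSrc (ColP.of ⟨_, _, Pre.of j y rfl rfl⟩) := h''
    refine ColP.ext ?_ ?_ fun c => ?_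
    · refine Eq.trans ?_ (s_colComp _ _ h').symm
      show cls F j _ = cls F j _
      rw [(F.obj j).s_comp]
    · refine Eq.trans ?_ (t_colComp _ _ h').symm
      show cls F j _ = cls F j _
      rw [(F.obj j).t_comp]
    · refine Eq.trans ?_ (evalP_colComp c _ _ h' (by
        rw [s_evalP, t_evalP]; exact congrArg (evalS c) h')).symm
      exact FlowHom.comp_map (c.ι.app j) x y h _

/-- The colimit cocone. -/
noncomputable def colCocone : Limits.Cocone F where
  pt := colFlow F
  ι :=
    { app := fun j => colIncl F j
      naturality := fun j k φ => FlowHom.ext (funext fun x => cls_map F φ x)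
        (funext fun x => ColP.ext
          ((congrArg (cls F k) (FlowHom.s_map (F.map φ) x)).trans (cls_map F φ _))
          ((congrArg (cls F k) (FlowHom.t_map (F.map φ) x)).trans (cls_map F φ _))
          (fun c => cocone_wP c φ x)) }

/-- The universal map out of the colimit. -/
noncomputable def colDesc (c : Limits.Cocone F) : FlowHom (colFlow F) c.pt where
  toFun0 := evalS c
  toFunP := evalP c
  continuous_toFunP := continuous_evalP c
  s_map := s_evalP c
  t_map := t_evalP c
  comp_map x y h h' := evalP_colComp c x y h h'

/-- The colimit cocone is a colimit. -/
noncomputable def colIsColimit : Limits.IsColimit (colCocone F) where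
  desc c := colDesc F c
  fac c j := rfl
  uniq c m hm := by
    have h0 : FlowHom.toFun0 m = evalS c := by
      funext x
      induction x using Quot.ind with
      | _ x => exact congrFun (congrArg FlowHom.toFun0 (hm x.1)) x.2
    refine FlowHom.ext h0 (funext fun x => ?_)
    induction x using ColP.ind with
    | _ x =>
    obtain ⟨a, b, x⟩ := x
    induction x with
    | of j p ha hb =>
      subst ha hb
      exact congrFun (congrArg FlowHom.toFunP (hm j)) p
    | @comp a b b' c' h x y ihx ihy =>
      have hxy : colTgt (ColP.of ⟨a, b, x⟩) =
        colSrc (ColP.of ⟨b', c', y⟩) := h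
      have e : (ColP.of ⟨a, c', Pre.comp h x y⟩ : ColP F) =
          colComp (ColP.of ⟨a, b, x⟩) (ColP.of ⟨b', c', y⟩)
            hxy := by
        refine ColP.ext (s_colComp _ _ hxy).symm (t_colComp _ _ hxy).symm fun d => ?_
        refine Eq.trans ?_ (evalP_colComp d _ _ hxy (by rw [s_evalP, t_evalP, hxy])).symm
        rfl
      rw [e]
      let X : (colCocone F).pt.Path := ColP.of ⟨a, b, x⟩
      let Y : (colCocone F).pt.Path := ColP.of ⟨b', c', y⟩
      have hXY : (colCocone F).pt.t X = (colCocone F).pt.s Y := hxy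
      have hh : c.pt.t (FlowHom.toFunP m X) = c.pt.s (FlowHom.toFunP m Y) :=
        (FlowHom.t_map m X).trans ((congrArg _ hXY).trans (FlowHom.s_map m Y).symm)
      refine (FlowHom.comp_map m X Y hXY hh).trans ?_
      refine (Flow.comp_congr _ hh ihx ihy).trans ?_
      exact (FlowHom.comp_map (colDesc F c) X Y hXY _).symm

end Colimits

theorem hasColimits_flow : Limits.HasColimits Flow :=
  ⟨fun _ _ => ⟨fun F => ⟨⟨colCocone F, colIsColimit F⟩⟩⟩⟩

end PartD

section PartE

/-! ### Cells and lifting properties -/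

/-- The inclusion of globes associated with a subspace. -/
def globIncl {L : Type} [TopologicalSpace L] (K : Set L) : Glob K ⟶ Glob L :=
  Glob.map ⟨Subtype.val, continuous_subtype_val⟩

/-- A morphism out of a globe. -/
def globHom {L : Type} [TopologicalSpace L] {X : Flow} (a b : X.State) (k : C(L, X.Path))
    (hs : ∀ x, X.s (k x) = a) (ht : ∀ x, X.t (k x) = b) : Glob L ⟶ X where
  toFun0 := fun i : Fin 2 => if i = 0 then a else b
  toFunP := k
  continuous_toFunP := k.continuous
  s_map x := (hs x).trans rfl
  t_map x := (ht x).trans rfl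
  comp_map x y h := absurd (show (1 : Fin 2) = 0 from h) (by decide)

theorem globHom_eq {L : Type} [TopologicalSpace L] {X : Flow} (a b : X.State) (k : C(L, X.Path))
    (hs : ∀ x, X.s (k x) = a) (ht : ∀ x, X.t (k x) = b) (g : FlowHom (Glob L) X)
    (h0 : g.toFun0 (0 : Fin 2) = a) (h1 : g.toFun0 (1 : Fin 2) = b)
    (hk : ∀ x : L, g.toFunP x = k x) : globHom a b k hs ht = g := by
  refine FlowHom.ext (funext fun i => ?_) (funext fun x => (hk x).symm)
  have : ∀ i : Fin 2, (if i = 0 then a else b) = g.toFun0 i := by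
    intro i
    fin_cases i
    · exact h0.symm
    · exact h1.symm
  exact this i

theorem glob_s {L : Type} [TopologicalSpace L] {X : Flow} (g : FlowHom (Glob L) X) (x : L) :
    X.s (g.toFunP x) = g.toFun0 (0 : Fin 2) := g.s_map x

theorem glob_t {L : Type} [TopologicalSpace L] {X : Flow} (g : FlowHom (Glob L) X) (x : L) :
    X.t (g.toFunP x) = g.toFun0 (1 : Fin 2) := g.t_map x

theorem Flow.s_const {L : Type} [TopologicalSpace L] [PreconnectedSpace L] {X : Flow}
    (l : C(L, X.Path)) (x y : L) : X.s (l x) = X.s (l y) :=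
  PreconnectedSpace.constant inferInstance (X.continuous_s.comp l.continuous)

theorem Flow.t_const {L : Type} [TopologicalSpace L] [PreconnectedSpace L] {X : Flow}
    (l : C(L, X.Path)) (x y : L) : X.t (l x) = X.t (l y) :=
  PreconnectedSpace.constant inferInstance (X.continuous_t.comp l.continuous)

theorem hom_w0 {A B X Y : Flow} {i : A ⟶ B} {f : X ⟶ Y} {u : A ⟶ X} {v : B ⟶ Y}
    (h : u ≫ f = i ≫ v) (x : A.State) :
    FlowHom.toFun0 f (FlowHom.toFun0 u x) = FlowHom.toFun0 v (FlowHom.toFun0 i x) :=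
  congrFun (congrArg FlowHom.toFun0 h) x

theorem hom_wP {A B X Y : Flow} {i : A ⟶ B} {f : X ⟶ Y} {u : A ⟶ X} {v : B ⟶ Y}
    (h : u ≫ f = i ≫ v) (x : A.Path) :
    FlowHom.toFunP f (FlowHom.toFunP u x) = FlowHom.toFunP v (FlowHom.toFunP i x) :=
  congrFun (congrArg FlowHom.toFunP h) x

theorem lift_of_lifts {L : Type} [TopologicalSpace L] [ConnectedSpace L] {K : Set L}
    {X Y : Flow} (f : X ⟶ Y)
    (hK : K.Nonempty ∨ Function.Injective (FlowHom.toFun0 f))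
    (h : Lifts (FlowHom.pathMap f) K) : HasLiftingProperty (globIncl K) f where
  sq_hasLift {u v} sq := by
    obtain ⟨l, h1, h2⟩ := h (FlowHom.pathMap u) (FlowHom.pathMap v) (fun x => hom_wP sq.w x)
    have h1 : ∀ x : L, FlowHom.toFunP f (l x) = FlowHom.toFunP v x := h1
    have h2 : ∀ x : K, l x = FlowHom.toFunP u x := h2
    have w0 : ∀ i : Fin 2, FlowHom.toFun0 f (FlowHom.toFun0 u i) = FlowHom.toFun0 v i :=
      fun i => hom_w0 sq.w i
    have hs : ∀ x, X.s (l x) = FlowHom.toFun0 u (0 : Fin 2) := by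
      intro x
      rcases hK with ⟨y, hy⟩ | hi
      · rw [Flow.s_const l x y, h2 ⟨y, hy⟩]
        exact glob_s u _
      · apply hi
        rw [w0, ← FlowHom.s_map, h1]
        exact glob_s v _
    have ht : ∀ x, X.t (l x) = FlowHom.toFun0 u (1 : Fin 2) := by
      intro x
      rcases hK with ⟨y, hy⟩ | hi
      · rw [Flow.t_const l x y, h2 ⟨y, hy⟩]
        exact glob_t u _
      · apply hi
        rw [w0, ← FlowHom.t_map, h1]
        exact glob_t v _
    refine ⟨⟨⟨globHom _ _ l hs ht, ?_, ?_⟩⟩⟩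
    · refine FlowHom.ext (funext fun i => ?_) (funext fun x => h2 x)
      have : ∀ i : Fin 2, (if i = 0 then FlowHom.toFun0 u (0 : Fin 2)
          else FlowHom.toFun0 u (1 : Fin 2)) = FlowHom.toFun0 u i := by
        intro i; fin_cases i <;> rfl
      exact this i
    · refine FlowHom.ext (funext fun i => ?_) (funext fun x => h1 x)
      have : ∀ i : Fin 2, FlowHom.toFun0 f (if i = 0 then FlowHom.toFun0 u (0 : Fin 2)
          else FlowHom.toFun0 u (1 : Fin 2)) = FlowHom.toFun0 v i := by
        intro i; fin_cases i
        · exact w0 _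
        · exact w0 _
      exact this i

theorem lifts_of_lift {L : Type} [TopologicalSpace L] [ConnectedSpace L] {K : Set L}
    {X Y : Flow} (f : X ⟶ Y)
    (hK : (K.Nonempty ∧ _root_.IsPreconnected K) ∨ Function.Bijective (FlowHom.toFun0 f))
    (h : HasLiftingProperty (globIncl K) f) : Lifts (FlowHom.pathMap f) K := by
  intro k b hkb
  have hkb : ∀ x : K, FlowHom.toFunP f (k x) = b x := hkb
  obtain ⟨y⟩ : Nonempty L := inferInstance
  obtain ⟨a0, a1, hs, ht, hs', ht'⟩ : ∃ a0 a1 : X.State, (∀ x, X.s (k x) = a0) ∧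
      (∀ x, X.t (k x) = a1) ∧ FlowHom.toFun0 f a0 = Y.s (b y) ∧
        FlowHom.toFun0 f a1 = Y.t (b y) := by
    rcases hK with ⟨⟨z, hz⟩, hc⟩ | hb
    · have : PreconnectedSpace K := isPreconnected_iff_preconnectedSpace.1 hc
      refine ⟨X.s (k ⟨z, hz⟩), X.t (k ⟨z, hz⟩), fun x => Flow.s_const k _ _,
        fun x => Flow.t_const k _ _, ?_, ?_⟩
      · rw [← FlowHom.s_map, hkb]; exact Flow.s_const b _ _
      · rw [← FlowHom.t_map, hkb]; exact Flow.t_const b _ _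
    · obtain ⟨a0, h0⟩ := hb.2 (Y.s (b y))
      obtain ⟨a1, h1⟩ := hb.2 (Y.t (b y))
      refine ⟨a0, a1, fun x => hb.1 ?_, fun x => hb.1 ?_, h0, h1⟩
      · rw [h0, ← FlowHom.s_map, hkb]; exact Flow.s_const b _ _
      · rw [h1, ← FlowHom.t_map, hkb]; exact Flow.t_const b _ _
  have sq : CommSq (globHom a0 a1 k hs ht) (globIncl K) f
      (globHom (Y.s (b y)) (Y.t (b y)) b (fun x => Flow.s_const b _ _)
        (fun x => Flow.t_const b _ _)) := by
    constructor
    refine FlowHom.ext (funext fun i => ?_) (funext fun x => hkb x)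
    have : ∀ i : Fin 2, FlowHom.toFun0 f (if i = 0 then a0 else a1) =
        if i = 0 then Y.s (b y) else Y.t (b y) := by
      intro i; fin_cases i
      · exact hs'
      · exact ht'
    exact this i
  have := h.sq_hasLift sq
  refine ⟨FlowHom.pathMap sq.lift, fun x => ?_, fun x => ?_⟩
  · exact congrFun (congrArg FlowHom.toFunP sq.fac_right) x
  · exact congrFun (congrArg FlowHom.toFunP sq.fac_left) x

/-- A cell: a connected space with a closed subset. -/
structure Cell : Type 1 where
  /-- the space -/
  L : Type
  [top : TopologicalSpace L]
  /-- the boundary -/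
  K : Set L
  closed : IsClosed K
  conn : ConnectedSpace L

attribute [instance] Cell.top Cell.conn

/-- The set of morphisms associated with a family of cells. -/
def cellMaps {ι : Type} (c : ι → Cell) : MorphismProperty Flow :=
  MorphismProperty.ofHoms (fun i => globIncl (c i).K)

theorem rlp_cellMaps {ι : Type} (c : ι → Cell) {X Y : Flow} (f : X ⟶ Y) :
    (cellMaps c).rlp f ↔ ∀ i, HasLiftingProperty (globIncl (c i).K) f := by
  constructor
  · intro h i
    exact h _ ⟨i⟩
  · rintro h _ _ _ ⟨i⟩
    exact h i

theorem isPreconnected_box (n : ℕ) : _root_.IsPreconnected (box (dCb n)) := by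
  obtain ⟨r, h1, h2⟩ := (isBall_cb n).hep
  have : box (dCb n) = Set.range r := by
    ext p
    exact ⟨fun hp => ⟨p, h2 p hp⟩, fun ⟨q, hq⟩ => hq ▸ h1 q⟩
  rw [this]
  exact isPreconnected_range r.continuous

theorem nonempty_box (n : ℕ) : (box (dCb n)).Nonempty :=
  ⟨(fun _ => 0, 0), Or.inl rfl⟩

instance (n : ℕ) : ConnectedSpace (Cb n) := inferInstanceAs (ConnectedSpace (Fin n → unitInterval))

/-- Generating trivial cofibrations. -/
def cellJ (n : ℕ) : Cell where
  L := Cb n × unitInterval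
  K := box (dCb n)
  closed := isClosed_box (isBall_cb n).isClosed
  conn := inferInstance

/-- Generating cofibrations. -/
def cellI : ℕ ⊕ ℕ ⊕ ℕ → Cell
  | .inl n => cellJ n
  | .inr (.inl n) => ⟨Cb n, dCb n, (isBall_cb n).isClosed, inferInstance⟩
  | .inr (.inr n) => ⟨Cb n × unitInterval, bdry (dCb n), isClosed_bdry (isBall_cb n).isClosed,
      inferInstance⟩

theorem rlpJ_iff {X Y : Flow} (f : X ⟶ Y) :
    (cellMaps cellJ).rlp f ↔ ∀ n, Lifts (FlowHom.pathMap f) (box (dCb n)) := by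
  rw [rlp_cellMaps]
  exact forall_congr' fun n =>
    ⟨lifts_of_lift f (Or.inl ⟨nonempty_box n, isPreconnected_box n⟩),
      lift_of_lifts f (Or.inl (nonempty_box n))⟩

theorem rlpI_of {X Y : Flow} (f : X ⟶ Y) (hf : Function.Bijective (FlowHom.toFun0 f))
    (hJ : (cellMaps cellJ).rlp f) (hw : IsWeakSHomotopyEquiv f) : (cellMaps cellI).rlp f := by
  have hJ' := (rlpJ_iff f).1 hJ
  have hw' := (isWeakHomotopyEquiv_iff _).1 hw.2
  rw [rlp_cellMaps] at hJ ⊢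
  rintro (n | n | n)
  · exact hJ n
  · exact lift_of_lifts f (Or.inr hf.1) (lifts_dCb hJ' hw' n)
  · exact lift_of_lifts f (Or.inr hf.1) (lifts_bdry hJ' hw' n)

theorem rlpJ_of_rlpI {X Y : Flow} (f : X ⟶ Y) (hI : (cellMaps cellI).rlp f) :
    (cellMaps cellJ).rlp f := by
  rw [rlp_cellMaps] at hI ⊢
  exact fun n => hI (.inl n)

theorem weq_of_rlpI {X Y : Flow} (f : X ⟶ Y) (hf : Function.Bijective (FlowHom.toFun0 f))
    (hI : (cellMaps cellI).rlp f) : IsWeakSHomotopyEquiv f := by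
  rw [rlp_cellMaps] at hI
  refine ⟨hf, (isWeakHomotopyEquiv_iff _).2 (WE.of_lifts (fun n => ?_) fun n => ?_)⟩
  · exact lifts_of_lift f (Or.inr hf) (hI (.inr (.inl n)))
  · exact lifts_of_lift f (Or.inr hf) (hI (.inr (.inr n)))

end PartE

section PartF

/-! ### Chaotic flows -/

/-- The chaotic flow on a set of states. -/
def chaos (T : Type) : Flow where
  State := T
  Path := T × T
  topPath := ⊥
  s := Prod.fst
  t := Prod.snd
  isOpen_preimage_s a := trivial
  isOpen_preimage_t a := trivial
  comp x y h := (x.1, y.2)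
  continuous_comp := by
    let _ : TopologicalSpace (T × T) := ⊥
    have _ : DiscreteTopology (T × T) := ⟨rfl⟩
    exact continuous_of_discreteTopology
  s_comp x y h := rfl
  t_comp x y h := rfl
  comp_assoc x y z _ _ _ _ := rfl

/-- Morphisms to a chaotic flow. -/
def toChaos {X : Flow} {T : Type} (f : X.State → T) : X ⟶ chaos T where
  toFun0 := f
  toFunP p := (f (X.s p), f (X.t p))
  continuous_toFunP := by
    let _ : TopologicalSpace (T × T) := ⊥
    have _ : DiscreteTopology (T × T) := ⟨rfl⟩
    exact (continuous_of_discreteTopology (f := fun q : X.State × X.State => (f q.1, f q.2))).comp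
      (X.continuous_s.prodMk X.continuous_t)
  s_map x := rfl
  t_map x := rfl
  comp_map x y h h' := by rw [X.s_comp, X.t_comp]; rfl

theorem chaos_ext {X : Flow} {T : Type} {f g : X ⟶ chaos T}
    (h : FlowHom.toFun0 f = FlowHom.toFun0 g) : f = g := by
  refine FlowHom.ext h (funext fun x => Prod.ext ?_ ?_)
  · exact (FlowHom.s_map f x).trans ((congrFun h _).trans (FlowHom.s_map g x).symm)
  · exact (FlowHom.t_map f x).trans ((congrFun h _).trans (FlowHom.t_map g x).symm)

/-- The final flow. -/
abbrev ptFlow : Flow := chaos PUnit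

theorem pt_ext {X : Flow} (f g : X ⟶ ptFlow) : f = g := chaos_ext (funext fun _ => rfl)

/-- The map to the final flow. -/
def toPt (X : Flow) : X ⟶ ptFlow := toChaos fun _ => PUnit.unit

/-! ### Path objects -/

/-- Product of two flows. -/
def prodFlow (X Y : Flow) : Flow where
  State := X.State × Y.State
  Path := X.Path × Y.Path
  s p := (X.s p.1, Y.s p.2)
  t p := (X.t p.1, Y.t p.2)
  isOpen_preimage_s a := (isOpen_discrete {a}).preimage
    ((X.continuous_s.comp continuous_fst).prodMk (Y.continuous_s.comp continuous_snd))
  isOpen_preimage_t a := (isOpen_discrete {a}).preimage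
    ((X.continuous_t.comp continuous_fst).prodMk (Y.continuous_t.comp continuous_snd))
  comp x y h := (X.comp x.1 y.1 (congrArg Prod.fst h), Y.comp x.2 y.2 (congrArg Prod.snd h))
  continuous_comp := by
    refine (X.continuous_comp' ?_ ?_ _).prodMk (Y.continuous_comp' ?_ ?_ _)
    · exact continuous_fst.comp (continuous_fst.comp continuous_subtype_val)
    · exact continuous_fst.comp (continuous_snd.comp continuous_subtype_val)
    · exact continuous_snd.comp (continuous_fst.comp continuous_subtype_val)
    · exact continuous_snd.comp (continuous_snd.comp continuous_subtype_val)
  s_comp x y h := Prod.ext (X.s_comp _ _ _) (Y.s_comp _ _ _)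
  t_comp x y h := Prod.ext (X.t_comp _ _ _) (Y.t_comp _ _ _)
  comp_assoc x y z _ _ _ _ := Prod.ext (X.comp_assoc _ _ _ _ _ _ _) (Y.comp_assoc _ _ _ _ _ _ _)

/-- Pairing. -/
def prodLift {Z X Y : Flow} (f : Z ⟶ X) (g : Z ⟶ Y) : Z ⟶ prodFlow X Y where
  toFun0 x := (FlowHom.toFun0 f x, FlowHom.toFun0 g x)
  toFunP x := (FlowHom.toFunP f x, FlowHom.toFunP g x)
  continuous_toFunP := (FlowHom.continuous_toFunP f).prodMk (FlowHom.continuous_toFunP g)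
  s_map x := Prod.ext (FlowHom.s_map f x) (FlowHom.s_map g x)
  t_map x := Prod.ext (FlowHom.t_map f x) (FlowHom.t_map g x)
  comp_map x y h h' := Prod.ext (FlowHom.comp_map f x y h _) (FlowHom.comp_map g x y h _)

/-- The path object of a flow. -/
def cyl (B : Flow) : Flow where
  State := B.State
  Path := C(unitInterval, B.Path)
  s γ := B.s (γ 0)
  t γ := B.t (γ 0)
  isOpen_preimage_s a := (isOpen_discrete {a}).preimage
    (B.continuous_s.comp (continuous_eval_const 0))
  isOpen_preimage_t a := (isOpen_discrete {a}).preimage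
    (B.continuous_t.comp (continuous_eval_const 0))
  comp γ δ h := ⟨fun u => B.comp (γ u) (δ u)
      ((Flow.t_const γ u 0).trans (h.trans (Flow.s_const δ 0 u))),
    B.continuous_comp' γ.continuous δ.continuous _⟩
  continuous_comp := by
    refine ContinuousMap.continuous_of_continuous_uncurry _ ?_
    refine B.continuous_comp' ?_ ?_ _
    · exact ContinuousEval.continuous_eval.comp ((continuous_fst.comp
        (continuous_subtype_val.comp continuous_fst)).prodMk continuous_snd)
    · exact ContinuousEval.continuous_eval.comp ((continuous_snd.comp
        (continuous_subtype_val.comp continuous_fst)).prodMk continuous_snd)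
  s_comp x y h := B.s_comp _ _ _
  t_comp x y h := B.t_comp _ _ _
  comp_assoc x y z _ _ _ _ := ContinuousMap.ext fun u => B.comp_assoc _ _ _ _ _ _ _

/-- Constant paths. -/
def cylConst (B : Flow) : B ⟶ cyl B where
  toFun0 := id
  toFunP x := ContinuousMap.const _ x
  continuous_toFunP := ContinuousMap.continuous_const'
  s_map x := rfl
  t_map x := rfl
  comp_map x y h h' := rfl

/-- End points. -/
def cylEv (B : Flow) : cyl B ⟶ prodFlow B B where
  toFun0 a := (a, a)
  toFunP γ := (ContinuousMap.toFun γ 0, ContinuousMap.toFun γ 1)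
  continuous_toFunP := (continuous_eval_const (F := C(unitInterval, B.Path)) 0).prodMk
    (continuous_eval_const (F := C(unitInterval, B.Path)) 1)
  s_map x := Prod.ext rfl (Flow.s_const (L := unitInterval) x _ _)
  t_map x := Prod.ext rfl (Flow.t_const (L := unitInterval) x _ _)
  comp_map x y h h' := rfl

theorem lifts_ev {Y : Type} [TopologicalSpace Y] (e : C(C(unitInterval, Y), Y × Y))
    (he : ∀ γ, e γ = (γ 0, γ 1)) (n : ℕ) : Lifts e (box (dCb n)) := by
  classical
  intro k b hkb
  simp only [he] at hkb
  have hA : IsClosed (dCb n) := (isBall_cb n).isClosed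
  have hbox : IsClosed (box (dCb n)) := isClosed_box hA
  let g : (Cb n × unitInterval) × unitInterval → Y := fun q =>
    if h : (q.1.1, q.2) ∈ box (dCb n) then k ⟨(q.1.1, q.2), h⟩ q.1.2
    else if q.1.2 = 0 then (b (q.1.1, q.2)).1 else (b (q.1.1, q.2)).2
  have hc : Continuous fun q : (Cb n × unitInterval) × unitInterval => (q.1.1, q.2) := by fun_prop
  have hcu : Continuous fun q : (Cb n × unitInterval) × unitInterval => q.1.2 := by fun_prop
  have g0 : ∀ q : (Cb n × unitInterval) × unitInterval, q.1.2 = 0 → g q = (b (q.1.1, q.2)).1 := by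
    intro q hq
    by_cases h : (q.1.1, q.2) ∈ box (dCb n)
    · simp only [g, dif_pos h, hq]
      exact congrArg Prod.fst (hkb ⟨_, h⟩)
    · simp only [g, dif_neg h, hq, if_pos]
  have g1 : ∀ q : (Cb n × unitInterval) × unitInterval, q.1.2 = 1 → g q = (b (q.1.1, q.2)).2 := by
    intro q hq
    by_cases h : (q.1.1, q.2) ∈ box (dCb n)
    · simp only [g, dif_pos h, hq]
      exact congrArg Prod.snd (hkb ⟨_, h⟩)
    · simp only [g, dif_neg h, hq]
      rw [if_neg one_ne_zero]
  have gk : ∀ q : (Cb n × unitInterval) × unitInterval, ∀ h : (q.1.1, q.2) ∈ box (dCb n),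
      g q = k ⟨(q.1.1, q.2), h⟩ q.1.2 := fun q h => by simp only [g, dif_pos h]
  have c0 : ContinuousOn g {q | q.1.2 = 0} :=
    (continuous_fst.comp (b.continuous.comp hc)).continuousOn.congr g0
  have c1 : ContinuousOn g {q | q.1.2 = 1} :=
    (continuous_snd.comp (b.continuous.comp hc)).continuousOn.congr g1
  have ck : ContinuousOn g {q | (q.1.1, q.2) ∈ box (dCb n)} := by
    rw [continuousOn_iff_continuous_domRestrict]
    have : Continuous fun q : {q : (Cb n × unitInterval) × unitInterval |
        (q.1.1, q.2) ∈ box (dCb n)} => k ⟨(q.1.1.1, q.1.2), q.2⟩ q.1.1.2 :=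
      ContinuousEval.continuous_eval.comp ((k.continuous.comp
        ((hc.comp continuous_subtype_val).subtype_mk _)).prodMk
          (hcu.comp continuous_subtype_val))
    exact this.congr fun q => (gk q.1 q.2).symm
  have hcont : ContinuousOn g (box (bdry (dCb n))) := by
    have := (ck.union_of_isClosed c0 (hbox.preimage hc)
      (isClosed_singleton.preimage hcu)).union_of_isClosed c1
      ((hbox.preimage hc).union (isClosed_singleton.preimage hcu))
      (isClosed_singleton.preimage hcu)
    refine this.mono ?_
    rintro ⟨⟨x, u⟩, t⟩ h
    simp only [box, bdry, Set.mem_ofPred_eq, Set.mem_union] at h ⊢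
    rcases h with h | h | h | h
    · exact Or.inl (Or.inl (Or.inl h))
    · exact Or.inr h
    · exact Or.inl (Or.inr h)
    · exact Or.inl (Or.inl (Or.inr h))
  obtain ⟨l, hl⟩ := (isBall_cb n).bdry.hep.extend g hcont
  refine ⟨⟨fun p => ⟨fun u => l ((p.1, u), p.2), by fun_prop⟩,
    ContinuousMap.continuous_of_continuous_uncurry _ ?_⟩, fun p => ?_, fun p => ?_⟩
  · show Continuous fun q : (Cb n × unitInterval) × unitInterval => l ((q.1.1, q.2), q.1.2)
    fun_prop
  · rw [he]
    refine Prod.ext ?_ ?_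
    · show l ((p.1, 0), p.2) = _
      rw [hl _ (Or.inr (Or.inr (Or.inl rfl))), g0 _ rfl]
    · show l ((p.1, 1), p.2) = _
      rw [hl _ (Or.inr (Or.inl rfl)), g1 _ rfl]
  · ext u
    show l ((p.1.1, u), p.1.2) = _
    have hp : p.1 ∈ box (dCb n) := p.2
    rw [hl, gk _ p.2]
    rcases hp with h | h
    · exact Or.inl h
    · exact Or.inr (Or.inr (Or.inr h))

theorem rlpJ_cylEv (B : Flow) : (cellMaps cellJ).rlp (cylEv B) :=
  (rlpJ_iff _).2 fun n => lifts_ev _ (fun _ => rfl) n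

theorem rlpJ_toPt (A : Flow) : (cellMaps cellJ).rlp (toPt A) := by
  refine (rlpJ_iff _).2 fun n => ?_
  intro k b hkb
  obtain ⟨r, h1, h2⟩ := (isBall_cb n).hep
  refine ⟨⟨fun p => k ⟨r p, h1 p⟩, k.continuous.comp (r.continuous.subtype_mk _)⟩,
    fun p => rfl, fun p => ?_⟩
  show k ⟨r p, h1 p⟩ = k p
  congr 1
  exact Subtype.ext (h2 p p.2)

theorem weq_of_llpJ {A B : Flow} (i : A ⟶ B) (hi : (cellMaps cellJ).rlp.llp i) :
    IsWeakSHomotopyEquiv i := by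
  have sq1 : CommSq (𝟙 A) i (toPt A) (toPt B) := ⟨pt_ext _ _⟩
  have := (hi _ (rlpJ_toPt A)).sq_hasLift sq1
  let r : B ⟶ A := sq1.lift
  have hr : i ≫ r = 𝟙 A := sq1.fac_left
  have sq2 : CommSq (i ≫ cylConst B) i (cylEv B) (prodLift (𝟙 B) (r ≫ i)) := by
    constructor
    have h1 : i ≫ r ≫ i = i := by rw [← Category.assoc, hr, Category.id_comp]
    refine FlowHom.ext (funext fun a => ?_) (funext fun x => ?_)
    · exact Prod.ext rfl (congrFun (congrArg FlowHom.toFun0 h1) a).symm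
    · exact Prod.ext rfl (congrFun (congrArg FlowHom.toFunP h1) x).symm
  have := (hi _ (rlpJ_cylEv B)).sq_hasLift sq2
  let H : B ⟶ cyl B := sq2.lift
  have hH1 : H ≫ cylEv B = prodLift (𝟙 B) (r ≫ i) := sq2.fac_right
  have hH2 : i ≫ H = i ≫ cylConst B := sq2.fac_left
  have hr0 : ∀ a, FlowHom.toFun0 r (FlowHom.toFun0 i a) = a :=
    fun a => congrFun (congrArg FlowHom.toFun0 hr) a
  have hrP : ∀ a, FlowHom.toFunP r (FlowHom.toFunP i a) = a :=
    fun a => congrFun (congrArg FlowHom.toFunP hr) a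
  have h0 : ∀ b, FlowHom.toFun0 i (FlowHom.toFun0 r b) = b := by
    intro b
    have h := congrFun (congrArg FlowHom.toFun0 hH1) b
    have e1 : FlowHom.toFun0 H b = b := congrArg Prod.fst h
    have e2 : FlowHom.toFun0 H b = FlowHom.toFun0 i (FlowHom.toFun0 r b) := congrArg Prod.snd h
    exact e2.symm.trans e1
  refine ⟨⟨fun a a' h => ?_, fun b => ⟨FlowHom.toFun0 r b, h0 b⟩⟩,
    (isWeakHomotopyEquiv_iff _).2 ?_⟩
  · rw [← hr0 a, ← hr0 a', h]
  · let h : C(B.Path, C(unitInterval, B.Path)) := FlowHom.pathMap H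
    refine WE.of_sdr (FlowHom.pathMap i) (FlowHom.pathMap r) hrP
      ⟨fun p => h p.1 p.2, by fun_prop⟩ (fun y => ?_) (fun y => ?_) (fun x t => ?_)
    · exact congrArg Prod.fst (congrFun (congrArg FlowHom.toFunP hH1) y)
    · exact congrArg Prod.snd (congrFun (congrArg FlowHom.toFunP hH1) y)
    · have := congrFun (congrArg FlowHom.toFunP hH2) x
      exact congrArg (fun γ : C(unitInterval, B.Path) => γ t) this

end PartF

section PartG

/-! ### Bijections on states as a left class -/

/-- The class of all maps between chaotic flows. -/
def chaosMaps : MorphismProperty Flow :=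
  MorphismProperty.ofHoms (fun x : Σ (T T' : Type), (T → T') =>
    (toChaos (X := chaos x.1) x.2.2 : chaos x.1 ⟶ chaos x.2.1))

theorem bij_iff {A B : Flow} (i : A ⟶ B) :
    Function.Bijective (FlowHom.toFun0 i) ↔ chaosMaps.llp i := by
  constructor
  · rintro h _ _ _ ⟨⟨T, T', φ⟩⟩
    constructor
    intro u v sq
    let e := Equiv.ofBijective _ h
    refine ⟨⟨⟨toChaos (fun b => FlowHom.toFun0 u (e.symm b)), ?_, ?_⟩⟩⟩
    · refine chaos_ext (funext fun a => ?_)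
      exact congrArg (FlowHom.toFun0 u) (e.symm_apply_apply a)
    · refine chaos_ext (funext fun b => ?_)
      refine (hom_w0 sq.w (e.symm b)).trans ?_
      exact congrArg (FlowHom.toFun0 v) (e.apply_symm_apply b)
  · intro h
    constructor
    · have sq : CommSq (toChaos (X := A) (id : A.State → A.State)) i
          (toChaos (X := chaos A.State) (fun _ => PUnit.unit)) (toPt B) := ⟨pt_ext _ _⟩
      have _ : sq.HasLift := (h _ (MorphismProperty.ofHoms.mk
        (f := fun x : Σ (T T' : Type), (T → T') =>
          (toChaos (X := chaos x.1) x.2.2 : chaos x.1 ⟶ chaos x.2.1))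
        ⟨A.State, PUnit, fun _ => PUnit.unit⟩)).sq_hasLift sq
      have e : ∀ a, FlowHom.toFun0 sq.lift (FlowHom.toFun0 i a) = a :=
        fun a => congrFun (congrArg FlowHom.toFun0 sq.fac_left) a
      exact Function.LeftInverse.injective e
    · have sq : CommSq (toPt A) i (toChaos (X := chaos PUnit) (fun _ => True))
          (toChaos (fun b => b ∈ Set.range (FlowHom.toFun0 i))) := by
        constructor
        refine chaos_ext (funext fun a => ?_)
        exact (eq_true (Set.mem_range_self a)).symm
      have _ : sq.HasLift := (h _ (MorphismProperty.ofHoms.mk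
        (f := fun x : Σ (T T' : Type), (T → T') =>
          (toChaos (X := chaos x.1) x.2.2 : chaos x.1 ⟶ chaos x.2.1))
        ⟨PUnit, Prop, fun _ => True⟩)).sq_hasLift sq
      intro b
      have e : True = (b ∈ Set.range (FlowHom.toFun0 i)) :=
        congrFun (congrArg FlowHom.toFun0 sq.fac_right) b
      exact cast e trivial

theorem bij_of_llp_cellMaps {ι : Type} (c : ι → Cell) {A B : Flow} (i : A ⟶ B)
    (hi : (cellMaps c).rlp.llp i) : Function.Bijective (FlowHom.toFun0 i) := by
  rw [bij_iff]
  refine MorphismProperty.antitone_llp ?_ _ hi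
  rw [← MorphismProperty.le_llp_iff_le_rlp]
  rintro _ _ _ ⟨i⟩
  rw [← bij_iff]
  exact Function.bijective_id

/-! ### Embedding a flow in a flow which is injective for closed inclusions -/

/-- Paths of the flow obtained by adding generic paths. -/
inductive HatP (X : Flow) : Type
  | of (x : X.Path) : HatP X
  | inf (a b : X.State) : HatP X

variable {X : Flow}

/-- source -/
def HatP.s : HatP X → X.State
  | .of x => X.s x
  | .inf a _ => a

/-- target -/
def HatP.t : HatP X → X.State
  | .of x => X.t x
  | .inf _ b => b

instance : TopologicalSpace (HatP X) where
  IsOpen U := IsOpen (HatP.of ⁻¹' U) ∧ ∀ x, HatP.of x ∈ U → HatP.inf (X.s x) (X.t x) ∈ U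
  isOpen_univ := ⟨isOpen_univ, fun _ _ => trivial⟩
  isOpen_inter U V hU hV := ⟨hU.1.inter hV.1, fun x hx => ⟨hU.2 x hx.1, hV.2 x hx.2⟩⟩
  isOpen_sUnion S hS := by
    refine ⟨?_, ?_⟩
    · rw [Set.preimage_sUnion]
      exact isOpen_biUnion fun U hU => (hS U hU).1
    · rintro x ⟨U, hU, hx⟩
      exact ⟨U, hU, (hS U hU).2 x hx⟩

theorem HatP.isOpen_iff (U : Set (HatP X)) : IsOpen U ↔
    IsOpen (HatP.of ⁻¹' U) ∧ ∀ x, HatP.of x ∈ U → HatP.inf (X.s x) (X.t x) ∈ U := Iff.rfl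

/-- composition -/
def HatP.comp : ∀ p q : HatP X, HatP.t p = HatP.s q → HatP X
  | .of x, .of y, h => .of (X.comp x y h)
  | .of x, .inf _ c, _ => .inf (X.s x) c
  | .inf a _, .of y, _ => .inf a (X.t y)
  | .inf a _, .inf _ c, _ => .inf a c

theorem HatP.s_comp (p q : HatP X) (h : p.t = q.s) : (p.comp q h).s = p.s := by
  cases p <;> cases q <;> first | exact X.s_comp _ _ _ | rfl

theorem HatP.t_comp (p q : HatP X) (h : p.t = q.s) : (p.comp q h).t = q.t := by
  cases p <;> cases q <;> first | exact X.t_comp _ _ _ | rfl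

theorem HatP.continuous_of : Continuous (HatP.of (X := X)) := ⟨fun U hU => hU.1⟩

theorem HatP.isOpen_s (S : Set X.State) : IsOpen (HatP.s ⁻¹' S : Set (HatP X)) :=
  ⟨(isOpen_discrete S).preimage X.continuous_s, fun x hx => hx⟩

theorem HatP.isOpen_t (S : Set X.State) : IsOpen (HatP.t ⁻¹' S : Set (HatP X)) :=
  ⟨(isOpen_discrete S).preimage X.continuous_t, fun x hx => hx⟩

theorem HatP.isOpen_inf (a b : X.State) : IsOpen ({HatP.inf a b} : Set (HatP X)) := by
  refine ⟨?_, fun x hx => by cases hx⟩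
  convert isOpen_empty
  ext x
  simp

/-- The standard neighbourhoods. -/
theorem HatP.isOpen_nhd {V : Set X.Path} (hV : IsOpen V) (a b : X.State) :
    IsOpen ({p : HatP X | (∃ x ∈ V, X.s x = a ∧ X.t x = b ∧ p = .of x) ∨ p = .inf a b}) := by
  refine ⟨?_, ?_⟩
  · convert (hV.inter ((isOpen_discrete {a}).preimage X.continuous_s)).inter
      ((isOpen_discrete {b}).preimage X.continuous_t)
    ext x
    constructor
    · rintro (⟨y, hy, h1, h2, h3⟩ | h)
      · cases h3; exact ⟨⟨hy, h1⟩, h2⟩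
      · cases h
    · rintro ⟨⟨hy, h1⟩, h2⟩
      exact Or.inl ⟨x, hy, h1, h2, rfl⟩
  · rintro x (⟨y, hy, h1, h2, h3⟩ | h)
    · cases h3
      subst h1 h2
      exact Or.inr rfl
    · cases h

theorem HatP.continuous_comp : Continuous
    (fun p : { p : HatP X × HatP X // p.1.t = p.2.s } => HatP.comp p.1.1 p.1.2 p.2) := by
  rw [continuous_iff_continuousAt]
  rintro ⟨⟨p, q⟩, h⟩
  rw [ContinuousAt, tendsto_nhds]
  intro U hU hpq
  have key : ∃ V W : Set (HatP X), IsOpen V ∧ IsOpen W ∧ p ∈ V ∧ q ∈ W ∧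
      ∀ p' ∈ V, ∀ q' ∈ W, ∀ h' : p'.t = q'.s, HatP.comp p' q' h' ∈ U := by
    match p, q, h, hpq with
    | .of x, .of y, h, hpq =>
      have h : X.t x = X.s y := h
      have hpq : HatP.of (X.comp x y h) ∈ U := hpq
      have hpi : HatP.inf (X.s x) (X.t y) ∈ U := by
        have := hU.2 _ hpq
        rwa [X.s_comp, X.t_comp] at this
      have hc := X.continuous_comp.continuousAt (x := ⟨(x, y), h⟩)
      have hc' := hc.preimage_mem_nhds (hU.1.mem_nhds hpq)
      rw [nhds_induced, Filter.mem_comap] at hc'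
      obtain ⟨N, hN, hN'⟩ := hc'
      obtain ⟨V, W, hV, hxV, hW, hyW, hVW⟩ := mem_nhds_prod_iff'.1 hN
      refine ⟨_, _, HatP.isOpen_nhd hV (X.s x) (X.t x), HatP.isOpen_nhd hW (X.s y) (X.t y),
        Or.inl ⟨x, hxV, rfl, rfl, rfl⟩, Or.inl ⟨y, hyW, rfl, rfl, rfl⟩, ?_⟩
      rintro p' (⟨x', hx', h1, h2, rfl⟩ | rfl) q' (⟨y', hy', h1', h2', rfl⟩ | rfl) h'
      · have : (⟨(x', y'), h'⟩ : { p : X.Path × X.Path // X.t p.1 = X.s p.2 }) ∈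
            Subtype.val ⁻¹' N := hVW (Set.mk_mem_prod hx' hy')
        exact hN' this
      · show HatP.inf (X.s x') (X.t y) ∈ U
        rwa [h1]
      · show HatP.inf (X.s x) (X.t y') ∈ U
        rwa [h2']
      · exact hpi
    | .of x, .inf b c, h, hpq =>
      refine ⟨HatP.s ⁻¹' {X.s x}, _, HatP.isOpen_s _, HatP.isOpen_inf b c, rfl, rfl, ?_⟩
      rintro p' hp' q' rfl h'
      have hp' : p'.s = X.s x := hp'
      have hpq : HatP.inf (X.s x) c ∈ U := hpq
      rw [← hp'] at hpq
      cases p' <;> exact hpq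
    | .inf a b, .of y, h, hpq =>
      refine ⟨_, HatP.t ⁻¹' {X.t y}, HatP.isOpen_inf a b, HatP.isOpen_t _, rfl, rfl, ?_⟩
      rintro p' rfl q' hq' h'
      have hq' : q'.t = X.t y := hq'
      have hpq : HatP.inf a (X.t y) ∈ U := hpq
      rw [← hq'] at hpq
      cases q' <;> exact hpq
    | .inf a b, .inf b' c, h, hpq =>
      refine ⟨_, _, HatP.isOpen_inf a b, HatP.isOpen_inf b' c, rfl, rfl, ?_⟩
      rintro p' rfl q' rfl h'
      exact hpq
  obtain ⟨V, W, hV, hW, hp, hq, H⟩ := key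
  have hVW : IsOpen (Subtype.val ⁻¹' (V ×ˢ W) : Set { p : HatP X × HatP X // p.1.t = p.2.s }) :=
    (hV.prod hW).preimage continuous_subtype_val
  refine Filter.mem_of_superset (hVW.mem_nhds ⟨hp, hq⟩) ?_
  rintro ⟨⟨p', q'⟩, h'⟩ ⟨h1, h2⟩
  exact H p' h1 q' h2 h'

variable (X)

/-- The flow obtained by adding generic paths. -/
def hat : Flow where
  State := X.State
  Path := HatP X
  s := HatP.s
  t := HatP.t
  isOpen_preimage_s a := HatP.isOpen_s _
  isOpen_preimage_t a := HatP.isOpen_t _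
  comp := HatP.comp
  continuous_comp := HatP.continuous_comp
  s_comp := HatP.s_comp
  t_comp := HatP.t_comp
  comp_assoc x y z h h' h1 h2 := by
    match x, y, z with
    | .of x, .of y, .of z => exact congrArg HatP.of (X.comp_assoc x y z h h' h1 h2)
    | .of x, .of y, .inf a b =>
      exact congrArg (HatP.inf · b) (X.s_comp x y h).symm
    | .inf a b, .of y, .of z =>
      exact congrArg (HatP.inf a ·) (X.t_comp y z h')
    | .of x, .inf a b, .of z => rfl
    | .of x, .inf a b, .inf c d => rfl
    | .inf a b, .of x, .inf c d => rfl
    | .inf a b, .inf c d, .of x => rfl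
    | .inf a b, .inf c d, .inf e f => rfl

/-- The embedding. -/
def hatIncl : X ⟶ hat X where
  toFun0 := id
  toFunP := HatP.of
  continuous_toFunP := HatP.continuous_of
  s_map x := rfl
  t_map x := rfl
  comp_map x y h h' := rfl

theorem isEmbedding_hatOf : Topology.IsEmbedding (HatP.of (X := X)) where
  injective x y h := by cases h; rfl
  eq_induced := by
    refine le_antisymm HatP.continuous_of.le_induced ?_
    intro U hU
    refine ⟨{p | ∀ x, p = .of x → x ∈ U}, ⟨?_, fun x hx y hy => by cases hy⟩, ?_⟩
    · convert hU
      ext x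
      exact ⟨fun h => h x rfl, fun h y hy => by cases hy; exact h⟩
    · ext x
      exact ⟨fun h => h x rfl, fun h y hy => by cases hy; exact h⟩

theorem hat_lift {L : Type} [TopologicalSpace L] {K : Set L} (hK : IsClosed K) :
    HasLiftingProperty (globIncl K) (toPt (hat X)) where
  sq_hasLift {u v} sq := by
    classical
    let k : C(K, HatP X) := FlowHom.pathMap u
    let a : X.State := @FlowHom.toFun0 (Glob K) (hat X) u (0 : Fin 2)
    let b : X.State := @FlowHom.toFun0 (Glob K) (hat X) u (1 : Fin 2)
    have ks : ∀ x, (k x).s = a := fun x => glob_s u x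
    have kt : ∀ x, (k x).t = b := fun x => glob_t u x
    let l : L → HatP X := fun x => if h : x ∈ K then k ⟨x, h⟩ else .inf a b
    have lk : ∀ x (h : x ∈ K), l x = k ⟨x, h⟩ := fun x h => dif_pos h
    have ls : ∀ x, (l x).s = a := by
      intro x
      by_cases h : x ∈ K
      · rw [lk x h]; exact ks _
      · simp only [l, dif_neg h]; rfl
    have lt : ∀ x, (l x).t = b := by
      intro x
      by_cases h : x ∈ K
      · rw [lk x h]; exact kt _
      · simp only [l, dif_neg h]; rfl
    have hl : Continuous l := by
      refine ⟨fun U hU => ?_⟩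
      by_cases hab : HatP.inf a b ∈ U
      · have hcl : IsClosed (Subtype.val '' (k ⁻¹' Uᶜ)) :=
          hK.isClosedMap_subtype_val _ ((isClosed_compl_iff.2 hU).preimage k.continuous)
        rw [← isClosed_compl_iff]
        convert hcl
        ext x
        constructor
        · intro hx
          by_cases h : x ∈ K
          · refine ⟨⟨x, h⟩, ?_, rfl⟩
            intro h'
            exact hx (show l x ∈ U by rw [lk x h]; exact h')
          · exact absurd (show l x ∈ U by simp only [l, dif_neg h]; exact hab) hx
        · rintro ⟨⟨y, hy⟩, h1, rfl⟩ h2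
          exact h1 (show k ⟨y, hy⟩ ∈ U by rw [← lk y hy]; exact h2)
      · convert isOpen_empty
        refine Set.eq_empty_of_forall_notMem fun x hx => hab ?_
        have hx : l x ∈ U := hx
        have h1 := ls x
        have h2 := lt x
        cases hlx : l x with
        | of y =>
          rw [hlx] at hx h1 h2
          have := hU.2 y hx
          have e1 : X.s y = a := h1
          have e2 : X.t y = b := h2
          rwa [e1, e2] at this
        | inf c d =>
          rw [hlx] at hx h1 h2
          have e1 : c = a := h1
          have e2 : d = b := h2
          rwa [e1, e2] at hx
    refine ⟨⟨⟨globHom (X := hat X) a b ⟨l, hl⟩ ls lt, ?_, pt_ext _ _⟩⟩⟩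
    refine FlowHom.ext (funext fun i => ?_) (funext fun x => lk x.1 x.2)
    have : ∀ i : Fin 2, (if i = 0 then a else b) = @FlowHom.toFun0 (Glob K) (hat X) u i := by
      intro i; fin_cases i <;> rfl
    exact this i

theorem embedding_of_llp {ι : Type} (c : ι → Cell) {A B : Flow} (i : A ⟶ B)
    (hi : (cellMaps c).rlp.llp i) : Topology.IsEmbedding (FlowHom.toFunP i) := by
  have hr : (cellMaps c).rlp (toPt (hat A)) :=
    (rlp_cellMaps c _).2 fun j => hat_lift A (c j).closed
  have sq : CommSq (hatIncl A) i (toPt (hat A)) (toPt B) := ⟨pt_ext _ _⟩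
  have := (hi _ hr).sq_hasLift sq
  refine Topology.IsEmbedding.of_comp (FlowHom.continuous_toFunP i)
    (FlowHom.continuous_toFunP sq.lift) ?_
  have e : FlowHom.toFunP sq.lift ∘ FlowHom.toFunP i = HatP.of :=
    congrArg FlowHom.toFunP sq.fac_left
  rw [e]
  exact isEmbedding_hatOf A

end PartG

section PartH

/-! ### Smallness -/

theorem factor_of_embedding {A B Y : Flow} (i : B ⟶ Y) (g : A ⟶ Y)
    (hb : Function.Bijective (FlowHom.toFun0 i)) (he : Topology.IsEmbedding (FlowHom.toFunP i))
    (hg : ∀ x, ∃ z, FlowHom.toFunP i z = FlowHom.toFunP g x) :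
    ∃ g' : A ⟶ B, g' ≫ i = g := by
  choose φ hφ using hg
  let e := Equiv.ofBijective _ hb
  have h0 : ∀ a, FlowHom.toFun0 i (e.symm (FlowHom.toFun0 g a)) = FlowHom.toFun0 g a :=
    fun a => e.apply_symm_apply _
  have hφc : Continuous φ := by
    rw [he.continuous_iff]
    have : FlowHom.toFunP i ∘ φ = FlowHom.toFunP g := funext hφ
    rw [this]
    exact FlowHom.continuous_toFunP g
  let g' : FlowHom A B :=
    { toFun0 := fun a => e.symm (FlowHom.toFun0 g a)
      toFunP := φ
      continuous_toFunP := hφc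
      s_map := fun x => hb.1 (by rw [h0, ← FlowHom.s_map, ← FlowHom.s_map, hφ])
      t_map := fun x => hb.1 (by rw [h0, ← FlowHom.t_map, ← FlowHom.t_map, hφ])
      comp_map := fun x y h h' => he.injective (by
        have hh : Y.t (FlowHom.toFunP g x) = Y.s (FlowHom.toFunP g y) := by
          rw [FlowHom.t_map, FlowHom.s_map, h]
        have hh' : Y.t (FlowHom.toFunP i (φ x)) = Y.s (FlowHom.toFunP i (φ y)) := by
          rw [hφ, hφ, hh]
        rw [hφ, FlowHom.comp_map g x y h hh, FlowHom.comp_map i _ _ h' hh']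
        exact Flow.comp_congr Y _ (hφ x).symm (hφ y).symm) }
  exact ⟨g', FlowHom.ext (funext h0) (funext hφ)⟩

section
variable {J : Type} [LinearOrder J]

/-- The union of the images of a chain of flows. -/
theorem jointly_surjective {F : J ⥤ Flow} (c : Limits.Cocone F) (hc : Limits.IsColimit c)
    (hb : ∀ j, Function.Bijective (FlowHom.toFun0 (c.ι.app j))) (y : c.pt.Path) :
    ∃ j x, FlowHom.toFunP (c.ι.app j) x = y := by
  have hw : ∀ {j k : J} (h : j ≤ k) (x : (F.obj j).Path),
      FlowHom.toFunP (c.ι.app k) (FlowHom.toFunP (F.map (homOfLE h)) x) =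
        FlowHom.toFunP (c.ι.app j) x :=
    fun {j k} h x => congrFun (congrArg FlowHom.toFunP (c.w (homOfLE h))) x
  let Y : Flow := c.pt
  let P : Y.Path → Prop := fun y => ∃ (j : J) (x : (F.obj j).Path),
    FlowHom.toFunP (c.ι.app j) x = y
  have hP : ∀ y y' (h : Y.t y = Y.s y'), P y → P y' → P (Y.comp y y' h) := by
    rintro _ _ h ⟨j, x, rfl⟩ ⟨k, x', rfl⟩
    have e1 := hw (le_max_left j k) x
    have e2 := hw (le_max_right j k) x'
    have hh : (F.obj (max j k)).t (FlowHom.toFunP (F.map (homOfLE (le_max_left j k))) x) =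
        (F.obj (max j k)).s (FlowHom.toFunP (F.map (homOfLE (le_max_right j k))) x') := by
      apply (hb (max j k)).1
      refine (FlowHom.t_map (c.ι.app (max j k)) _).symm.trans
        (Eq.trans ?_ (FlowHom.s_map (c.ι.app (max j k)) _))
      refine (congrArg Y.t e1).trans (h.trans (congrArg Y.s e2).symm)
    refine ⟨max j k, (F.obj (max j k)).comp _ _ hh, ?_⟩
    refine (FlowHom.comp_map (c.ι.app (max j k)) _ _ hh ?_).trans ?_
    · exact (congrArg Y.t e1).trans (h.trans (congrArg Y.s e2).symm)
    · exact Flow.comp_congr Y _ e1 e2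
  let S : Flow :=
    { State := Y.State
      Path := {y // P y}
      s := fun y => Y.s y.1
      t := fun y => Y.t y.1
      isOpen_preimage_s := fun a => (Y.isOpen_preimage_s a).preimage continuous_subtype_val
      isOpen_preimage_t := fun a => (Y.isOpen_preimage_t a).preimage continuous_subtype_val
      comp := fun x y h => ⟨Y.comp x.1 y.1 h, hP _ _ h x.2 y.2⟩
      continuous_comp := by
        refine Continuous.subtype_mk ?_ _
        exact Flow.continuous_comp' (X := Y)
          (continuous_subtype_val.comp (continuous_fst.comp continuous_subtype_val))
          (continuous_subtype_val.comp (continuous_snd.comp continuous_subtype_val)) _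
      s_comp := fun x y h => Y.s_comp _ _ _
      t_comp := fun x y h => Y.t_comp _ _ _
      comp_assoc := fun x y z h h' h1 h2 => Subtype.ext (Y.comp_assoc _ _ _ _ _ _ _) }
  let incl : S ⟶ Y := 
    { toFun0 := id
      toFunP := Subtype.val
      continuous_toFunP := continuous_subtype_val
      s_map := fun _ => rfl
      t_map := fun _ => rfl
      comp_map := fun _ _ _ _ => rfl }
  let leg : ∀ j, F.obj j ⟶ S := fun j =>
    { toFun0 := (@FlowHom.toFun0 (F.obj j) Y (c.ι.app j) : (F.obj j).State → Y.State)
      toFunP := fun x => ⟨FlowHom.toFunP (c.ι.app j) x, j, x, rfl⟩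
      continuous_toFunP := Continuous.subtype_mk (FlowHom.continuous_toFunP (c.ι.app j)) _
      s_map := fun x => FlowHom.s_map (c.ι.app j) x
      t_map := fun x => FlowHom.t_map (c.ι.app j) x
      comp_map := fun x y h h' => Subtype.ext (FlowHom.comp_map (c.ι.app j) x y h h') }
  let d : Limits.Cocone F :=
    { pt := S
      ι := { app := leg
             naturality := fun j k f => by
              have e : F.map f ≫ c.ι.app k = c.ι.app j := c.w f
              refine FlowHom.ext (funext fun a => ?_) (funext fun x => ?_)
              · exact congrFun (congrArg FlowHom.toFun0 e) a
              · exact Subtype.ext (congrFun (congrArg FlowHom.toFunP e) x) } }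
  have hid : hc.desc d ≫ incl = 𝟙 c.pt := by
    refine hc.hom_ext fun j => ?_
    rw [← Category.assoc, hc.fac d j]
    exact FlowHom.ext rfl rfl
  have := (FlowHom.toFunP (hc.desc d) y).2
  obtain ⟨j, x, e⟩ := this
  refine ⟨j, x, e.trans ?_⟩
  exact congrFun (congrArg FlowHom.toFunP hid) y

end

theorem smallObj {ι : Type} (c : ι → Cell) :
    MorphismProperty.HasSmallObjectArgument.{0} (cellMaps c) := by
  let κ₀ : Cardinal.{0} := max Cardinal.aleph0 (Cardinal.mk (Σ i, (c i).K))
  let κ : Cardinal.{0} := Order.succ κ₀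
  have hreg : κ.IsRegular := Cardinal.isRegular_succ (le_max_left _ _)
  have fact : Fact κ.IsRegular := ⟨hreg⟩
  have hlt : ∀ i, HasCardinalLT (c i).K κ := by
    intro i
    rw [hasCardinalLT_iff_cardinal_mk_lt]
    refine Order.lt_succ_of_le (le_trans ?_ (le_max_right _ _))
    exact Cardinal.mk_le_of_injective (f := fun x => (⟨i, x⟩ : Σ i, (c i).K))
      (fun x y h => by simpa using h)
  have : Nonempty κ.ord.ToType := by
    rw [← Cardinal.mk_ne_zero_iff]
    simpa using hreg.pos.ne'
  let bot : OrderBot κ.ord.ToType := WellFoundedLT.toOrderBot _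
  have := hasColimits_flow
  have : MorphismProperty.IsSmall.{0} (cellMaps c) := by
    unfold cellMaps
    infer_instance
  refine ⟨κ, fact, bot, ?_⟩
  have key : ∀ {A B X Y : Flow} (i : A ⟶ B) (_ : cellMaps c i) (f : X ⟶ Y)
      (hf : HomotopicalAlgebra.RelativeCellComplex.{0}
        (fun (_ : κ.ord.ToType) => (cellMaps c).homFamily) f),
      Limits.PreservesColimit hf.F (coyoneda.obj (Opposite.op A)) := by
    intro A B X' Y' i hi f hf
    obtain ⟨i⟩ := hi
    have hllp : ∀ j, (cellMaps c).rlp.llp (hf.incl.app j) := by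
      intro j
      refine MorphismProperty.transfiniteCompositionsOfShape_pushouts_coproducts_le_llp_rlp.{0}
        (cellMaps c) (Set.Ici j) _ ⟨?_⟩
      exact MorphismProperty.TransfiniteCompositionOfShape.ici
        (hf.transfiniteCompositionOfShape' (I := cellMaps c) (fun s => s.i.2)) j
    have hb := fun j => bij_of_llp_cellMaps c _ (hllp j)
    have he := fun j => embedding_of_llp c _ (hllp j)
    have hcf : IsCardinalFiltered κ.ord.ToType κ := inferInstance
    have : IsFiltered κ.ord.ToType := isFiltered_of_isCardinalFiltered _ κ
    refine Limits.preservesColimit_of_preserves_colimit_cocone hf.isColimit ?_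
    refine Limits.Types.FilteredColimit.isColimitOf' _ _ ?_ ?_
    · intro (g : Glob (c i).K ⟶ Y')
      have hs := jointly_surjective _ hf.isColimit hb
      have hs : ∀ x : (c i).K, ∃ j z, FlowHom.toFunP (hf.incl.app j) z = FlowHom.toFunP g x :=
        fun x => hs (FlowHom.toFunP g x)
      choose φ z hz using hs
      let m : κ.ord.ToType := IsCardinalFiltered.max φ (hlt i)
      obtain ⟨g', hg'⟩ := factor_of_embedding (hf.incl.app m) g (hb m) (he m) (by
        intro x
        have e : hf.F.map (IsCardinalFiltered.toMax φ (hlt i) x) ≫ hf.incl.app m =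
          hf.incl.app (φ x) := (Limits.Cocone.mk Y' hf.incl).w _
        refine ⟨FlowHom.toFunP (hf.F.map (IsCardinalFiltered.toMax φ (hlt i) x)) (z x), ?_⟩
        exact (congrFun (congrArg FlowHom.toFunP e) (z x)).trans (hz x))
      exact ⟨m, g', hg'.symm⟩
    · intro j x y h
      refine ⟨j, 𝟙 j, congrArg _ ?_⟩
      have h : (show Glob (c i).K ⟶ hf.F.obj j from x) ≫ hf.incl.app j =
        (show Glob (c i).K ⟶ hf.F.obj j from y) ≫ hf.incl.app j := h
      refine FlowHom.ext (funext fun a => ?_) (funext fun a => ?_)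
      · exact (hb j).1 (congrFun (congrArg FlowHom.toFun0 h) a)
      · exact (he j).injective (congrFun (congrArg FlowHom.toFunP h) a)
  exact { preservesColimit := key }

end PartH

section PartI

/-! ### Discrete flows and the model structure -/

/-- The flow with a given set of states and no path. -/
def disc (T : Type) : Flow where
  State := T
  Path := Empty
  s := fun e => e.elim
  t := fun e => e.elim
  isOpen_preimage_s := fun a => by
    rw [Set.eq_empty_of_isEmpty (_ ⁻¹' {a})]; exact isOpen_empty
  isOpen_preimage_t := fun a => by
    rw [Set.eq_empty_of_isEmpty (_ ⁻¹' {a})]; exact isOpen_empty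
  comp := fun x _ _ => x.elim
  continuous_comp := continuous_of_isEmpty _
  s_comp := fun x => x.elim
  t_comp := fun x => x.elim
  comp_assoc := fun x => x.elim

/-- Maps out of a discrete flow. -/
def fromDisc {T : Type} {X : Flow} (φ : T → X.State) : disc T ⟶ X where
  toFun0 := φ
  toFunP := fun e : Empty => e.elim
  continuous_toFunP := ⟨fun U _ => by
    convert isOpen_empty
    exact Set.eq_empty_of_forall_notMem fun e : Empty => e.elim⟩
  s_map := fun e : Empty => e.elim
  t_map := fun e : Empty => e.elim
  comp_map := fun e : Empty => e.elim

theorem disc_ext {T : Type} {X : Flow} {f g : disc T ⟶ X}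
    (h : FlowHom.toFun0 f = FlowHom.toFun0 g) : f = g :=
  FlowHom.ext h (funext fun e : Empty => e.elim)

/-- Trivial fibrations. -/
def trivFib : MorphismProperty Flow := fun _ _ f =>
  Function.Bijective (FlowHom.toFun0 f) ∧ (cellMaps cellI).rlp f

theorem disc_llp {T T' : Type} (φ : T → T') :
    trivFib.llp (fromDisc (X := disc T') φ) := by
  intro X Y p hp
  constructor
  intro u v sq
  let e := Equiv.ofBijective _ hp.1
  have w : ∀ a : T, FlowHom.toFun0 p (FlowHom.toFun0 u a) = FlowHom.toFun0 v (φ a) :=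
    fun a => hom_w0 sq.w a
  refine ⟨⟨⟨fromDisc fun b => e.symm (FlowHom.toFun0 v b), disc_ext (funext fun a => ?_),
    disc_ext (funext fun b => ?_)⟩⟩⟩
  · exact e.symm_apply_eq.2 (w a).symm
  · exact e.apply_symm_apply _

theorem fact_I {X Y : Flow} (f : X ⟶ Y) :
    ∃ (Z : Flow) (i : X ⟶ Z) (p : Z ⟶ Y), trivFib.llp i ∧ trivFib p ∧ i ≫ p = f := by
  have := hasColimits_flow
  have := smallObj cellI
  let a : disc X.State ⟶ X := fromDisc id
  let b : disc X.State ⟶ disc Y.State := fromDisc (X := disc Y.State) (T := X.State)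
    (@FlowHom.toFun0 X Y f)
  obtain ⟨X', l, r, hp⟩ : ∃ (X' : Flow) (l : X ⟶ X') (r : disc Y.State ⟶ X'),
      IsPushout a b l r := ⟨_, _, _, IsPushout.of_hasPushout a b⟩
  have hl : trivFib.llp l := MorphismProperty.of_isPushout (f := b) hp (disc_llp _)
  have ha : chaosMaps.llp a := (bij_iff a).1 Function.bijective_id
  have hr : Function.Bijective (FlowHom.toFun0 r) :=
    (bij_iff r).2 (MorphismProperty.of_isPushout hp.flip ha)
  let v : disc Y.State ⟶ Y := fromDisc id
  have hw : a ≫ f = b ≫ v := disc_ext rfl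
  let f' : X' ⟶ Y := hp.desc f v hw
  have h1 : l ≫ f' = f := hp.inl_desc _ _ _
  have h2 : r ≫ f' = v := hp.inr_desc _ _ _
  have hf' : Function.Bijective (FlowHom.toFun0 f') := by
    refine (Function.Bijective.of_comp_iff (FlowHom.toFun0 f') hr).1 ?_
    have : FlowHom.toFun0 f' ∘ FlowHom.toFun0 r = id := congrArg FlowHom.toFun0 h2
    rw [this]
    exact Function.bijective_id
  obtain ⟨d⟩ := MorphismProperty.HasFactorization.nonempty_mapFactorizationData
    (W₁ := (cellMaps cellI).rlp.llp) (W₂ := (cellMaps cellI).rlp) f'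
  refine ⟨d.Z, l ≫ d.i, d.p, ?_, ⟨?_, d.hp⟩, ?_⟩
  · refine MorphismProperty.comp_mem _ _ _ hl ?_
    exact MorphismProperty.antitone_llp (fun _ _ f hf => hf.2) _ d.hi
  · refine (Function.Bijective.of_comp_iff (FlowHom.toFun0 d.p)
      (bij_of_llp_cellMaps cellI d.i d.hi)).1 ?_
    have : FlowHom.toFun0 d.p ∘ FlowHom.toFun0 d.i = FlowHom.toFun0 f' :=
      congrArg FlowHom.toFun0 d.fac
    rw [this]
    exact hf'
  · rw [Category.assoc, d.fac, h1]

theorem fact_J {X Y : Flow} (f : X ⟶ Y) :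
    ∃ (Z : Flow) (i : X ⟶ Z) (p : Z ⟶ Y), (cellMaps cellJ).rlp.llp i ∧
      (cellMaps cellJ).rlp p ∧ i ≫ p = f := by
  have := smallObj cellJ
  obtain ⟨d⟩ := MorphismProperty.HasFactorization.nonempty_mapFactorizationData
    (W₁ := (cellMaps cellJ).rlp.llp) (W₂ := (cellMaps cellJ).rlp) f
  exact ⟨d.Z, d.i, d.p, d.hi, d.hp, d.fac⟩

theorem weq_comp {X Y Z : Flow} (f : X ⟶ Y) (g : Y ⟶ Z) (hf : IsWeakSHomotopyEquiv f)
    (hg : IsWeakSHomotopyEquiv g) : IsWeakSHomotopyEquiv (f ≫ g) :=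
  ⟨hg.1.comp hf.1, (isWeakHomotopyEquiv_iff _).2
    (WE.comp ((isWeakHomotopyEquiv_iff _).1 hg.2) ((isWeakHomotopyEquiv_iff _).1 hf.2))⟩

theorem weq_postcomp {X Y Z : Flow} (f : X ⟶ Y) (g : Y ⟶ Z) (hg : IsWeakSHomotopyEquiv g)
    (hfg : IsWeakSHomotopyEquiv (f ≫ g)) : IsWeakSHomotopyEquiv f :=
  ⟨(Function.Bijective.of_comp_iff' hg.1 (FlowHom.toFun0 f)).1 hfg.1,
    (isWeakHomotopyEquiv_iff _).2 (WE.of_comp_left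
      ((isWeakHomotopyEquiv_iff _).1 hg.2) ((isWeakHomotopyEquiv_iff _).1 hfg.2))⟩

theorem weq_precomp {X Y Z : Flow} (f : X ⟶ Y) (g : Y ⟶ Z) (hf : IsWeakSHomotopyEquiv f)
    (hfg : IsWeakSHomotopyEquiv (f ≫ g)) : IsWeakSHomotopyEquiv g :=
  ⟨(Function.Bijective.of_comp_iff (FlowHom.toFun0 g) hf.1).1 hfg.1,
    (isWeakHomotopyEquiv_iff _).2 (WE.of_comp_right
      ((isWeakHomotopyEquiv_iff _).1 hf.2) ((isWeakHomotopyEquiv_iff _).1 hfg.2))⟩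

theorem weq_retract' {X Y Z W : Flow} (f : X ⟶ Y) (g : Z ⟶ W) (h : IsRetractOfHom f g)
    (hg : IsWeakSHomotopyEquiv g) : IsWeakSHomotopyEquiv f := by
  obtain ⟨i, r, i', r', h1, h2, h3, h4⟩ := h
  refine ⟨⟨?_, ?_⟩, (isWeakHomotopyEquiv_iff _).2 ?_⟩
  · intro a b hab
    have e : FlowHom.toFun0 i a = FlowHom.toFun0 i b := by
      apply hg.1.1
      refine (hom_w0 h3 a).trans (Eq.trans ?_ (hom_w0 h3 b).symm)
      exact congrArg _ hab
    have e1 : ∀ a, FlowHom.toFun0 r (FlowHom.toFun0 i a) = a :=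
      fun a => congrFun (congrArg FlowHom.toFun0 h1) a
    rw [← e1 a, e, e1]
  · intro b
    obtain ⟨z, hz⟩ := hg.1.2 (FlowHom.toFun0 i' b)
    refine ⟨FlowHom.toFun0 r z, ?_⟩
    have e2 : FlowHom.toFun0 r' (FlowHom.toFun0 i' b) = b :=
      congrFun (congrArg FlowHom.toFun0 h2) b
    have e4 : FlowHom.toFun0 r' (FlowHom.toFun0 g z) = FlowHom.toFun0 f (FlowHom.toFun0 r z) :=
      congrFun (congrArg FlowHom.toFun0 h4) z
    rw [← e4, ← e2]
    exact congrArg _ hz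
  · exact WE.retract (FlowHom.pathMap i) (FlowHom.pathMap r) (FlowHom.pathMap i')
      (FlowHom.pathMap r') (fun x => congrFun (congrArg FlowHom.toFunP h1) x)
      (fun x => congrFun (congrArg FlowHom.toFunP h2) x)
      (fun x => congrFun (congrArg FlowHom.toFunP h3) x)
      (fun x => congrFun (congrArg FlowHom.toFunP h4) x) ((isWeakHomotopyEquiv_iff _).1 hg.2)

theorem retractArrow_of {X Y Z W : Flow} (f : X ⟶ Y) (g : Z ⟶ W) (h : IsRetractOfHom f g) :
    Nonempty (RetractArrow f g) := by
  obtain ⟨i, r, i', r', h1, h2, h3, h4⟩ := h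
  exact ⟨{ i := Arrow.homMk i i' h3, r := Arrow.homMk r r' h4.symm
           retract := by ext <;> [exact h1; exact h2] }⟩

theorem llpJ_le : (cellMaps cellJ).rlp.llp ≤ trivFib.llp :=
  MorphismProperty.antitone_llp fun _ _ f hf => rlpJ_of_rlpI f hf.2

theorem lift_of_weq {A B : Flow} (i : A ⟶ B) (hi : trivFib.llp i)
    (hw : IsWeakSHomotopyEquiv i) : (cellMaps cellJ).rlp.llp i := by
  obtain ⟨Z, j, q, hj, hq, rfl⟩ := fact_J i
  have hqw := weq_precomp j q (weq_of_llpJ j hj) hw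
  have hl : HasLiftingProperty (j ≫ q) q := hi q ⟨hqw.1, rlpI_of q hqw.1 hq hqw⟩
  exact MorphismProperty.of_retract (RetractArrow.ofLeftLiftingProperty rfl) hj

/-- The model structure on flows. -/
def flowModel : ModelStructure Flow where
  weq := weakSHomotopyEquivalences
  cof := trivFib.llp
  fib := (cellMaps cellJ).rlp
  weq_two_out_of_three :=
    { comp_mem := fun f g hf hg => weq_comp f g hf hg
      of_postcomp := fun f g hg hfg => weq_postcomp f g hg hfg
      of_precomp := fun f g hf hfg => weq_precomp f g hf hfg }
  weq_retract f g h hg := weq_retract' f g h hg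
  cof_retract f g h hg := MorphismProperty.of_retract (retractArrow_of f g h).some hg
  fib_retract f g h hg := MorphismProperty.of_retract (retractArrow_of f g h).some hg
  lift_cof_trivFib i p hi hp hw := hi p ⟨hw.1, rlpI_of p hw.1 hp hw⟩
  lift_trivCof_fib i p hi hw hp := lift_of_weq i hi hw p hp
  fact_cof_trivFib f := by
    obtain ⟨Z, i, p, hi, hp, e⟩ := fact_I f
    exact ⟨Z, i, p, hi, rlpJ_of_rlpI p hp.2, weq_of_rlpI p hp.1 hp.2, e⟩
  fact_trivCof_fib f := by
    obtain ⟨Z, i, p, hi, hp, e⟩ := fact_J f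
    exact ⟨Z, i, p, llpJ_le _ hi, weq_of_llpJ i hi, hp, e⟩

end PartI

/-- there is a model category structure on the (complete and
cocomplete) category of flows whose weak equivalences are exactly the weak
S-homotopy equivalences. -/
theorem exists_modelStructure_flow :
    (Limits.HasLimits Flow ∧ Limits.HasColimits Flow) ∧
      ∃ M : ModelStructure Flow, M.weq = weakSHomotopyEquivalences :=
  ⟨⟨hasLimits_flow, hasColimits_flow⟩, flowModel, rfl⟩

end Gaucher
end

section
/- The functor FLOW(X,−) : Flow → Top does not commute with projective limits: there exist a flow X and a projective system of flows (Y_i) such that the canonical continuous map FLOW(X, lim Y_i) → lim FLOW(X, Y_i) is not a homeomorphism. Specifically, if X is the flow with one state and empty path space, then FLOW(X,Y) is the discrete space Y⁰ for any flow Y, while a projective limit of discrete spaces can be totally disconnected without being discrete. -/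
open CategoryTheory

namespace Gaucher

/-- The flow with state set `S` and no paths. -/
def discFlow (S : Type) : Flow where
  State := S
  Path := Empty
  s := fun e => e.elim
  t := fun e => e.elim
  isOpen_preimage_s := fun a => by
    rw [Set.eq_empty_of_isEmpty (_ ⁻¹' {a})]; exact isOpen_empty
  isOpen_preimage_t := fun a => by
    rw [Set.eq_empty_of_isEmpty (_ ⁻¹' {a})]; exact isOpen_empty
  comp := fun x _ _ => x.elim
  continuous_comp := continuous_of_isEmpty _
  s_comp := fun x => x.elim
  t_comp := fun x => x.elim
  comp_assoc := fun x => x.elim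

/-- A morphism out of a flow with no paths. -/
def homOfEmpty {X Y : Flow} (h : X.Path → Empty) (f : X.State → Y.State) : FlowHom X Y where
  toFun0 := f
  toFunP := fun x => (h x).elim
  continuous_toFunP := by
    haveI : IsEmpty X.Path := ⟨fun x => (h x).elim⟩
    exact continuous_of_isEmpty _
  s_map x := (h x).elim
  t_map x := (h x).elim
  comp_map x := (h x).elim

theorem hom_ext_of_empty {X Y : Flow} (h : X.Path → Empty) {f g : FlowHom X Y}
    (h0 : f.toFun0 = g.toFun0) : f = g :=
  FlowHom.ext h0 (funext fun x => (h x).elim)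

/-- The projective system of finite powers of `Bool`. -/
def boolSystem : (Finset ℕ)ᵒᵖ ⥤ Flow where
  obj j := discFlow (j.unop → Bool)
  map {i j} φ := homOfEmpty (X := discFlow (i.unop → Bool)) (Y := discFlow (j.unop → Bool))
    (fun x => x) (fun (p : i.unop → Bool) (k : j.unop) => p ⟨k.1, leOfHom φ.unop k.2⟩)
  map_id _ := hom_ext_of_empty (fun x => x) rfl
  map_comp _ _ := hom_ext_of_empty (fun x => x) rfl

/-- The limit cone, with states `ℕ → Bool`. -/
def boolCone : Limits.Cone boolSystem where
  pt := discFlow (ℕ → Bool)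
  π :=
    { app := fun j => homOfEmpty (X := discFlow (ℕ → Bool)) (Y := discFlow (j.unop → Bool))
        (fun x => x) (fun (p : ℕ → Bool) (k : j.unop) => p k.1)
      naturality := fun _ _ _ => hom_ext_of_empty (fun x => x) rfl }

/-- The cone is a limit cone. -/
def boolConeIsLimit : Limits.IsLimit boolCone where
  lift s := homOfEmpty (X := s.pt) (Y := discFlow (ℕ → Bool))
    (FlowHom.toFunP (s.π.app (Opposite.op ∅)))
    (fun x (n : ℕ) => (FlowHom.toFun0 (s.π.app (Opposite.op {n})) x : ({n} : Finset ℕ) → Bool)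
      ⟨n, Finset.mem_singleton_self n⟩)
  fac s j := by
    refine hom_ext_of_empty (X := s.pt) (FlowHom.toFunP (s.π.app (Opposite.op ∅))) ?_
    funext x
    refine funext (α := j.unop) (β := fun _ => Bool) fun k => ?_
    have hk : ({k.1} : Finset ℕ) ≤ j.unop := Finset.singleton_subset_iff.2 k.2
    have h := s.w (homOfLE hk).op
    have h' := congrFun (congrArg FlowHom.toFun0 h) x
    exact (congrFun (α := ({k.1} : Finset ℕ)) (β := fun _ => Bool) h'
      ⟨k.1, Finset.mem_singleton_self _⟩).symm
  uniq s m hm := by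
    refine hom_ext_of_empty (X := s.pt) (FlowHom.toFunP (s.π.app (Opposite.op ∅))) ?_
    funext x
    refine funext (α := ℕ) (β := fun _ => Bool) fun n => ?_
    have h' := congrFun (congrArg FlowHom.toFun0 (hm (Opposite.op {n}))) x
    exact (congrFun (α := ({n} : Finset ℕ)) (β := fun _ => Bool) h'
      ⟨n, Finset.mem_singleton_self _⟩)

theorem discrete_point (Y : Flow) : DiscreteTopology (FlowHom pointFlow Y) := by
  have h1 : flowHomInducedTop pointFlow Y = ⊥ := by
    letI := flowHomInducedTop pointFlow Y
    have hc : Continuous (FlowHom.toSumMap : FlowHom pointFlow Y → _) := continuous_induced_dom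
    have he : Continuous (fun f : FlowHom pointFlow Y => f.toSumMap (Sum.inl PUnit.unit)) :=
      (continuous_eval_const (F := C(pointFlow.State ⊕ pointFlow.Path, Y.State ⊕ Y.Path)) (Sum.inl PUnit.unit)).comp hc
    have : DiscreteTopology (FlowHom pointFlow Y) := by
      refine discreteTopology_iff_isOpen_singleton.2 fun g => ?_
      have ho : IsOpen (Sum.inl '' {g.toFun0 PUnit.unit} : Set (Y.State ⊕ Y.Path)) :=
        isOpenMap_inl _ (isOpen_discrete _)
      convert ho.preimage he using 1
      ext f
      simp only [Set.mem_singleton_iff, Set.image_singleton, Set.mem_preimage]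
      constructor
      · rintro rfl; rfl
      · intro h
        refine hom_ext_of_empty (X := pointFlow) (fun x => x) ?_
        funext x
        exact Sum.inl.inj h
    exact this.eq_bot
  refine ⟨?_⟩
  refine le_bot_iff.1 ?_
  refine le_trans ?_ h1.le
  letI := flowHomInducedTop pointFlow Y
  change TopologicalSpace.compactlyGenerated.{0} (FlowHom pointFlow Y) ≤ _
  simp only [TopologicalSpace.compactlyGenerated, ← continuous_iff_coinduced_le,
    continuous_sigma_iff, Sigma.forall]
  exact fun S f => f.2

/-- A state as a morphism out of the point. -/
def pointHom {Y : Flow} (y : Y.State) : FlowHom pointFlow Y :=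
  homOfEmpty (X := pointFlow) (fun x => x) (fun _ => y)

/-- the functor `FLOW(X, −)` does not commute with projective limits.
For the flow `X` with one state and empty path space, `FLOW(X, Y)` is the discrete
space `Y⁰` (the evaluation `f ↦ f(∗)` is a bijection onto the states), and there is
a projective (cofiltered) system `(Yⱼ)` of flows for which the canonical map
`FLOW(X, lim Yⱼ) → lim FLOW(X, Yⱼ)` is not a homeomorphism (a projective limit of
discrete spaces can be totally disconnected without being discrete). -/
theorem flowHomFunctor_not_commute_with_limits :
    (∀ Y : Flow, DiscreteTopology (FlowHom pointFlow Y) ∧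
      Function.Bijective (fun f : FlowHom pointFlow Y => f.toFun0 PUnit.unit)) ∧
    ∃ (J : Type) (instJ : SmallCategory J) (D : @Functor J instJ Flow _)
      (c : @Limits.Cone J instJ Flow _ D),
      Nonempty (@Limits.IsLimit J instJ Flow _ D c) ∧ @IsCofiltered J instJ ∧
      ¬ IsHomeomorph (@canonicalMapToLimit pointFlow J instJ D c) := by
  refine ⟨fun Y => ⟨discrete_point Y, ?_, ?_⟩, ?_⟩
  · intro f g h
    refine hom_ext_of_empty (X := pointFlow) (fun x => x) ?_
    funext x
    exact h
  · intro y
    exact ⟨pointHom y, rfl⟩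
  · refine ⟨(Finset ℕ)ᵒᵖ, inferInstance, boolSystem, boolCone, ⟨boolConeIsLimit⟩,
      inferInstance, fun hH => ?_⟩
    let u : ℕ → FlowHom pointFlow boolCone.pt := fun n =>
      pointHom (Y := discFlow (ℕ → Bool)) (fun k : ℕ => decide (k = n))
    let v : FlowHom pointFlow boolCone.pt :=
      pointHom (Y := discFlow (ℕ → Bool)) (fun _ : ℕ => false)
    have ht : Filter.Tendsto u Filter.atTop (nhds v) := by
      rw [hH.isEmbedding.isInducing.tendsto_nhds_iff, tendsto_subtype_rng, tendsto_pi_nhds]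
      intro j
      refine tendsto_nhds_of_eventually_eq ?_
      filter_upwards [Filter.eventually_gt_atTop (j.unop.sup id)] with n hn
      refine hom_ext_of_empty (X := pointFlow) (fun x => x) ?_
      funext x
      refine funext (α := j.unop) (β := fun _ => Bool) fun k => ?_
      have hk : k.1 ≤ j.unop.sup id := Finset.le_sup (f := id) k.2
      exact decide_eq_false (by omega)
    haveI := discrete_point boolCone.pt
    rw [nhds_discrete, Filter.tendsto_pure] at ht
    obtain ⟨n, hn⟩ := ht.exists
    have h1 := congrFun (congrArg FlowHom.toFun0 hn) PUnit.unit
    have h2 : decide (n = n) = false := congrFun (α := ℕ) (β := fun _ => Bool) h1 n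
    simp at h2

end Gaucher
end
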